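/- arXiv:1805.01462 — 4 statements merged into one kernel-verified Lean document; each statement's English description precedes it below -/
import Mathlib

section
/- Let 0 < x < 1, s > 0, and let α > z*, where z* ≈ 1.461632144 is the abscissa of the minimum of the gamma function on (0, ∞) (equivalently, Γ is strictly increasing on [z*, ∞)). Then the function β ↦ G_β(x, α, s) is log-concave on (-1, ∞): for all β₁, β₂ > -1 and λ ∈ [0, 1], G_{λβ₁+(1-λ)β₂}(x, α, s) ≥ G_{β₁}(x, α, s)^λ · G_{β₂}(x, α, s)^(1-λ). -/
open MeasureTheory Real Set

/-- The Volterra function `μ(x, β, α) = ∫₀^∞ x^(t+α) t^β / (Γ(t+α+1) Γ(β+1)) dt`. -/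
noncomputable def volterraMu (x β α : ℝ) : ℝ :=
  ∫ t in Set.Ioi (0 : ℝ),
    x ^ (t + α) * t ^ β / (Real.Gamma (t + α + 1) * Real.Gamma (β + 1))

/-- The incomplete Volterra function
`μ(x, β, α, s) = ∫_s^∞ x^(t+α) t^β / (Γ(t+α+1) Γ(β+1)) dt`. -/
noncomputable def volterraMuInc (x β α s : ℝ) : ℝ :=
  ∫ t in Set.Ioi s,
    x ^ (t + α) * t ^ β / (Real.Gamma (t + α + 1) * Real.Gamma (β + 1))

/-- The incomplete Volterra function from below
`μ*(x, β, α, s) = ∫₀^s x^(t+α) t^β / (Γ(t+α+1) Γ(β+1)) dt`. -/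
noncomputable def volterraMuIncStar (x β α s : ℝ) : ℝ :=
  ∫ t in Set.Ioc (0 : ℝ) s,
    x ^ (t + α) * t ^ β / (Real.Gamma (t + α + 1) * Real.Gamma (β + 1))

/-- The normalized incomplete Volterra function `G_β(x, α, s) = μ(x,β,α,s)/μ(x,β,α)`. -/
noncomputable def volterraG (β x α s : ℝ) : ℝ :=
  volterraMuInc x β α s / volterraMu x β α

/-- The normalized incomplete Volterra function from below
`G*_β(x, α, s) = μ*(x,β,α,s)/μ(x,β,α)`. -/
noncomputable def volterraGStar (β x α s : ℝ) : ℝ :=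
  volterraMuIncStar x β α s / volterraMu x β α

lemma vol_int_pos {f : ℝ → ℝ} {c p : ℝ} (hf : IntegrableOn f (Ioi c))
    (hpos : ∀ t, c < t → t ≠ p → 0 < f t) : 0 < ∫ t in Ioi c, f t := by
  rw [setIntegral_pos_iff_support_of_nonneg_ae _ hf]
  · have hsub : Ioi c \ {p} ⊆ Function.support f ∩ Ioi c := by
      rintro t ⟨ht, htp⟩
      exact ⟨(hpos t ht htp).ne', ht⟩
    refine lt_of_lt_of_le ?_ (measure_mono hsub)
    rw [measure_sdiff_null (by simp)]
    simp
  · have h1 : ∀ᵐ t ∂(volume : Measure ℝ), t ≠ p := by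
      simp [ae_iff]
    have h2 := ae_restrict_of_ae (s := Ioi c) h1
    filter_upwards [h2, ae_restrict_mem measurableSet_Ioi] with t ht htc
    exact (hpos t htc ht).le

lemma vol_kern {p q β₁ β β₂ : ℝ} (hp : 0 < p) (hpq : p < q) (h1 : β₁ < β) (h2 : β < β₂) :
    ∃ A B : ℝ, ∀ t, 0 < t →
      (p ≤ t → t ≤ q → A * t ^ β₁ + B * t ^ β₂ ≤ t ^ β) ∧
      ((t < p ∨ q < t) → t ^ β ≤ A * t ^ β₁ + B * t ^ β₂) := by
  set P := log p
  set Q := log q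
  have hPQ : P < Q := log_lt_log hp hpq
  set d := β - β₁ with hd
  set e := β₂ - β with he
  have hd0 : 0 < d := by simp [hd, h1]
  have he0 : 0 < e := by simp [he, h2]
  have i1 : rexp (-d * Q) < rexp (-d * P) := exp_lt_exp.2 (by nlinarith)
  have i2 : rexp (e * P) < rexp (e * Q) := exp_lt_exp.2 (by nlinarith)
  have z1 := exp_pos (-d * Q)
  have z2 := exp_pos (e * P)
  have hdet : 0 < rexp (-d * P) * rexp (e * Q) - rexp (-d * Q) * rexp (e * P) := by nlinarith
  set D := rexp (-d * P) * rexp (e * Q) - rexp (-d * Q) * rexp (e * P) with hD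
  obtain ⟨A, hA⟩ : ∃ A, A = (rexp (e * Q) - rexp (e * P)) / D := ⟨_, rfl⟩
  obtain ⟨B, hB⟩ : ∃ B, B = (rexp (-d * P) - rexp (-d * Q)) / D := ⟨_, rfl⟩
  have hA0 : 0 ≤ A := by rw [hA]; exact div_nonneg (by linarith) hdet.le
  have hB0 : 0 ≤ B := by rw [hB]; exact div_nonneg (by linarith) hdet.le
  set φ : ℝ → ℝ := fun u => A * rexp (-d * u) + B * rexp (e * u) with hφ
  have hconv : ConvexOn ℝ univ φ := by
    have c0 : ∀ k : ℝ, ConvexOn ℝ univ (fun u => rexp (k * u)) := by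
      intro k
      refine ⟨convex_univ, fun y _ z _ m n hm hn hmn => ?_⟩
      have := convexOn_exp.2 (mem_univ (k * y)) (mem_univ (k * z)) hm hn hmn
      simp only [smul_eq_mul] at this ⊢
      rw [show k * (m * y + n * z) = m * (k * y) + n * (k * z) by ring]
      exact this
    have c1 := c0 (-d)
    have c2 := c0 e
    exact (c1.smul hA0).add (c2.smul hB0)
  have fP : φ P = 1 := by
    simp only [hφ, hA, hB]
    field_simp
    rw [hD]; ring_nf
  have fQ : φ Q = 1 := by
    simp only [hφ, hA, hB]
    field_simp
    rw [hD]; ring_nf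
  refine ⟨A, B, fun t ht => ?_⟩
  have e0 := rpow_pos_of_pos ht β
  have e1 : A * t ^ β₁ + B * t ^ β₂ = t ^ β * φ (log t) := by
    simp only [hφ]
    rw [rpow_def_of_pos ht, rpow_def_of_pos ht, rpow_def_of_pos ht, mul_add, mul_left_comm,
      ← exp_add, mul_left_comm (rexp _) B, ← exp_add]
    congr 3 <;> (simp only [hd, he]; ring)
  rw [e1]
  constructor
  · intro a b
    have a' : P ≤ log t := log_le_log hp a
    have b' : log t ≤ Q := log_le_log ht b
    have : φ (log t) ≤ max (φ P) (φ Q) :=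
      hconv.le_max_of_mem_Icc (mem_univ _) (mem_univ _) ⟨a', b'⟩
    rw [fP, fQ, max_self] at this
    nlinarith
  · intro h
    have : 1 ≤ φ (log t) := by
      rcases h with h | h
      · have h' : log t < P := log_lt_log ht h
        have := hconv.le_left_of_right_le'' (mem_univ (log t)) (mem_univ Q) h'.le hPQ
          (by rw [fP, fQ])
        rwa [fP] at this
      · have h' : Q < log t := log_lt_log (hp.trans hpq) h
        have := hconv.le_right_of_left_le'' (mem_univ P) (mem_univ (log t)) hPQ h'.le
          (by rw [fP, fQ])
        rwa [fQ] at this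
    nlinarith

/-- reciprocal of truncated moments is convex -/
lemma vol_key {g : ℝ → ℝ} {β₁ β β₂ l : ℝ} (hg : ∀ t, 1 < t → 0 < g t)
    (hlc : ConcaveOn ℝ (Ioi 1) (fun t => log (g t)))
    (hint : ∀ γ : ℝ, -1 < γ → IntegrableOn (fun t => g t * t ^ γ) (Ioi 1))
    (hdec : ∀ b a : ℝ, 0 < a → ∃ T, ∀ t, T ≤ t → g t * t ^ b < a)
    (hβ1 : -1 < β₁) (h1 : β₁ < β) (h2 : β < β₂) (hl : β = l * β₁ + (1 - l) * β₂) :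
    (∫ t in Ioi 1, g t * t ^ β)⁻¹ ≤
      l * (∫ t in Ioi 1, g t * t ^ β₁)⁻¹ + (1 - l) * (∫ t in Ioi 1, g t * t ^ β₂)⁻¹ := by
  have Npos : ∀ γ : ℝ, -1 < γ → 0 < ∫ t in Ioi 1, g t * t ^ γ := fun γ hγ =>
    vol_int_pos (p := 0) (hint γ hγ)
      (fun t ht _ => mul_pos (hg t ht) (rpow_pos_of_pos (by linarith) _))
  have hβ : -1 < β := by linarith
  have hβ2 : -1 < β₂ := by linarith
  have N1 := Npos β₁ hβ1
  have N2 := Npos β₂ hβ2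
  have N0 := Npos β hβ
  have i1 := hint β₁ hβ1
  have i2 := hint β₂ hβ2
  have i0 := hint β hβ
  have h12 : (∫ t in Ioi 1, g t * t ^ β₁) < ∫ t in Ioi 1, g t * t ^ β₂ := by
    have := vol_int_pos (p := 0) (i2.sub i1) (fun t ht _ => by
      have : t ^ β₁ < t ^ β₂ := rpow_lt_rpow_of_exponent_lt ht (by linarith)
      have := mul_lt_mul_of_pos_left this (hg t ht)
      simpa using this)
    simp only [Pi.sub_apply] at this
    rw [integral_sub i2 i1] at this
    linarith
  set M1 := ∫ t in Ioi 1, g t * t ^ β₁ with hM1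
  set M2 := ∫ t in Ioi 1, g t * t ^ β₂ with hM2
  set M0 := ∫ t in Ioi 1, g t * t ^ β with hM0
  have hinv : M2⁻¹ < M1⁻¹ := inv_strictAnti₀ N1 h12
  obtain ⟨a, ha⟩ : ∃ a, a = (β₂ - β₁) / (M1⁻¹ - M2⁻¹) := ⟨_, rfl⟩
  have ha0 : 0 < a := by rw [ha]; exact div_pos (by linarith) (by linarith)
  have haM : a * (M1⁻¹ - M2⁻¹) = β₂ - β₁ := by
    rw [ha]; exact div_mul_cancel₀ _ (by linarith)
  obtain ⟨b, hb⟩ : ∃ b, b = 1 + β₁ + a * M1⁻¹ := ⟨_, rfl⟩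
  have hb2 : b = 1 + β₂ + a * M2⁻¹ := by rw [hb]; linarith
  have hap1 : 0 < a * M1⁻¹ := by positivity
  have hap2 : 0 < a * M2⁻¹ := by positivity
  have hb0 : 0 < b := by linarith
  -- comparison function
  have pint : ∀ γ : ℝ, γ < b - 1 → IntegrableOn (fun t : ℝ => a * t ^ (-b) * t ^ γ) (Ioi 1) ∧
      ∫ t in Ioi (1:ℝ), a * t ^ (-b) * t ^ γ = a / (b - 1 - γ) := by
    intro γ hγ
    have e : EqOn (fun t : ℝ => a * t ^ (-b + γ)) (fun t : ℝ => a * t ^ (-b) * t ^ γ) (Ioi 1) := by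
      intro t ht
      have : (0:ℝ) < t := lt_trans one_pos ht
      simp only
      rw [rpow_add this, mul_assoc]
    constructor
    · refine IntegrableOn.congr_fun ?_ e measurableSet_Ioi
      exact (integrableOn_Ioi_rpow_of_lt (by linarith) one_pos).const_mul a
    · rw [← setIntegral_congr_fun measurableSet_Ioi e, integral_const_mul,
        integral_Ioi_rpow_of_lt (by linarith) one_pos, one_rpow]
      have x1 : b - 1 - γ ≠ 0 := by linarith
      have x2 : -b + γ + 1 ≠ 0 := by linarith
      have x3 : -b + γ + 1 = -(b - 1 - γ) := by ring
      rw [x3]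
      field_simp
  obtain ⟨j1, k1⟩ := pint β₁ (by linarith)
  obtain ⟨j2, k2⟩ := pint β₂ (by linarith)
  obtain ⟨j0, k0⟩ := pint β (by linarith)
  have k1' : ∫ t in Ioi (1:ℝ), a * t ^ (-b) * t ^ β₁ = M1 := by
    rw [k1, hb]; have := ha0.ne'; field_simp; ring_nf
    try field_simp
  have k2' : ∫ t in Ioi (1:ℝ), a * t ^ (-b) * t ^ β₂ = M2 := by
    rw [k2, hb2]; have := ha0.ne'; field_simp; ring_nf
    try field_simp
  set D : ℝ → ℝ := fun t => g t - a * t ^ (-b) with hD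
  have DI : ∀ γ : ℝ, IntegrableOn (fun t => g t * t ^ γ) (Ioi 1) →
      IntegrableOn (fun t : ℝ => a * t ^ (-b) * t ^ γ) (Ioi 1) →
      IntegrableOn (fun t => D t * t ^ γ) (Ioi 1) ∧
      ∫ t in Ioi 1, D t * t ^ γ =
        (∫ t in Ioi 1, g t * t ^ γ) - ∫ t in Ioi (1:ℝ), a * t ^ (-b) * t ^ γ := by
    intro γ u v
    have e : (fun t => D t * t ^ γ) = fun t => g t * t ^ γ - a * t ^ (-b) * t ^ γ := by
      funext t; simp only [hD]; ring
    rw [e]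
    exact ⟨u.sub v, integral_sub u v⟩
  obtain ⟨m1, n1⟩ := DI _ i1 j1
  obtain ⟨m2, n2⟩ := DI _ i2 j2
  obtain ⟨m0, n0⟩ := DI _ i0 j0
  rw [k1', ← hM1, sub_self] at n1
  rw [k2', ← hM2, sub_self] at n2
  rw [k0, ← hM0] at n0
  -- sign structure
  set S : Set ℝ := {t | t ∈ Ioi (1:ℝ) ∧ log a ≤ (fun t => log (g t) + b * log t) t} with hS
  have cS : Convex ℝ S := by
    have c2 : ConcaveOn ℝ (Ioi (1:ℝ)) (fun t => b * log t) :=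
      ((strictConcaveOn_log_Ioi.concaveOn).subset (Ioi_subset_Ioi zero_le_one)
        (convex_Ioi 1)).smul hb0.le
    exact (hlc.add c2).convex_ge (log a)
  have memS : ∀ t, 1 < t → (t ∈ S ↔ 0 ≤ D t) := by
    intro t ht
    have t0 : 0 < t := by linarith
    have : log (g t) + b * log t = log (g t * t ^ b) := by
      rw [log_mul (hg t ht).ne' (rpow_pos_of_pos t0 _).ne', log_rpow t0]
    simp only [hS, mem_ofPred_eq, mem_Ioi, ht, true_and, hD, this]
    rw [log_le_log_iff ha0 (mul_pos (hg t ht) (rpow_pos_of_pos t0 _)), rpow_neg t0.le, sub_nonneg,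
      ← div_eq_mul_inv, div_le_iff₀ (rpow_pos_of_pos t0 _)]
  have bb : BddBelow S := ⟨1, fun t ht => le_of_lt ht.1⟩
  have ba : BddAbove S := by
    obtain ⟨T, hT⟩ := hdec b a ha0
    refine ⟨T, fun t ht => ?_⟩
    by_contra hc
    push Not at hc
    have t1 : 1 < t := ht.1
    have t0 : 0 < t := by linarith
    have h3 := (memS t t1).1 ht
    have h4 := hT t hc.le
    simp only [hD] at h3
    rw [rpow_neg t0.le, sub_nonneg, ← div_eq_mul_inv, div_le_iff₀ (rpow_pos_of_pos t0 _)] at h3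
    linarith
  have out : ∀ t, 1 < t → (t < sInf S ∨ sSup S < t) → D t < 0 := by
    intro t ht h
    by_contra hc
    push Not at hc
    have hm := (memS t ht).2 hc
    have := csInf_le bb hm
    have := le_csSup ba hm
    rcases h with h | h <;> linarith
  have hpq : sInf S < sSup S := by
    by_contra hc
    push Not at hc
    have := vol_int_pos (p := sInf S) m1.neg (fun t ht htp => by
      have : D t < 0 := by
        apply out t ht
        rcases lt_or_gt_of_ne htp with h | h
        · exact Or.inl h
        · exact Or.inr (by linarith)
      have := mul_pos_of_neg_of_neg this (neg_lt_zero.2 (rpow_pos_of_pos (show 0 < t by linarith) β₁))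
      simp only [Pi.neg_apply]
      linarith)
    simp only [Pi.neg_apply] at this
    rw [integral_neg, n1] at this
    simp at this
  have Sne : S.Nonempty := by
    by_contra hc
    rw [not_nonempty_iff_eq_empty] at hc
    rw [hc] at hpq
    simp at hpq
  have p1 : 1 ≤ sInf S := le_csInf Sne (fun t ht => le_of_lt ht.1)
  have ins : ∀ t, sInf S < t → t < sSup S → 0 ≤ D t := by
    intro t u v
    obtain ⟨y, hy, hyt⟩ := exists_lt_of_csInf_lt Sne u
    obtain ⟨z, hz, hzt⟩ := exists_lt_of_lt_csSup Sne v
    exact (memS t (by linarith)).1 (cS.ordConnected.out hy hz ⟨hyt.le, hzt.le⟩)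
  obtain ⟨A, B, hK⟩ := vol_kern (lt_of_lt_of_le one_pos p1) hpq h1 h2
  have hge : 0 ≤ ∫ t in Ioi 1, (D t * t ^ β - (A * (D t * t ^ β₁) + B * (D t * t ^ β₂))) := by
    apply setIntegral_nonneg_ae measurableSet_Ioi
    have y1 : ∀ᵐ t ∂(volume : Measure ℝ), t ≠ sInf S := by simp [ae_iff]
    have y2 : ∀ᵐ t ∂(volume : Measure ℝ), t ≠ sSup S := by simp [ae_iff]
    filter_upwards [y1, y2] with t ht1 ht2 ht
    have t1 : 1 < t := ht
    obtain ⟨w1, w2⟩ := hK t (by linarith)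
    have e : D t * t ^ β - (A * (D t * t ^ β₁) + B * (D t * t ^ β₂))
        = D t * (t ^ β - (A * t ^ β₁ + B * t ^ β₂)) := by ring
    rw [e]
    by_cases ho : t < sInf S ∨ sSup S < t
    · exact mul_nonneg_of_nonpos_of_nonpos (out t t1 ho).le (by linarith [w2 ho])
    · push Not at ho
      have u1 := lt_of_le_of_ne ho.1 ht1.symm
      have u2 := lt_of_le_of_ne ho.2 ht2
      exact mul_nonneg (ins t u1 u2) (by linarith [w1 ho.1 ho.2])
  have mm : IntegrableOn (fun t => A * (D t * t ^ β₁) + B * (D t * t ^ β₂)) (Ioi 1) :=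
    (m1.const_mul A).add (m2.const_mul B)
  rw [integral_sub m0 mm,
    integral_add (m1.const_mul A) (m2.const_mul B), integral_const_mul, integral_const_mul,
    n1, n2, n0] at hge
  have hle : a / (b - 1 - β) ≤ M0 := by linarith
  have hbb : 0 < b - 1 - β := by linarith
  have hfin : M0⁻¹ ≤ (b - 1 - β) / a := by
    rw [← inv_div]
    exact inv_anti₀ (div_pos ha0 hbb) hle
  refine hfin.trans (le_of_eq ?_)
  rw [div_eq_iff ha0.ne']
  have r1 : a * M1⁻¹ = b - 1 - β₁ := by linarith
  have r2 : a * M2⁻¹ = b - 1 - β₂ := by linarith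
  calc b - 1 - β = l * (b - 1 - β₁) + (1 - l) * (b - 1 - β₂) := by rw [hl]; ring
    _ = l * (a * M1⁻¹) + (1 - l) * (a * M2⁻¹) := by rw [r1, r2]
    _ = _ := by ring


lemma vol_scaled {w : ℝ → ℝ} {c β₁ β β₂ l : ℝ} (hw : ∀ t, 0 < t → 0 < w t)
    (hlc : ConcaveOn ℝ (Ioi 0) (fun t => log (w t)))
    (hint : ∀ γ : ℝ, -1 < γ → IntegrableOn (fun t => w t * t ^ γ) (Ioi 0))
    (hdec : ∀ b a : ℝ, 0 < a → ∃ T, ∀ t, T ≤ t → w (c * t) * t ^ b < a) (hc : 0 < c)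
    (hβ1 : -1 < β₁) (h1 : β₁ < β) (h2 : β < β₂) (hl : β = l * β₁ + (1 - l) * β₂) :
    c ^ β * (∫ t in Ioi c, w t * t ^ β)⁻¹ ≤
      l * (c ^ β₁ * (∫ t in Ioi c, w t * t ^ β₁)⁻¹) +
        (1 - l) * (c ^ β₂ * (∫ t in Ioi c, w t * t ^ β₂)⁻¹) := by
  have e : ∀ γ : ℝ, EqOn (fun t => c ^ (-γ) * (w (c * t) * (c * t) ^ γ))
      (fun t => w (c * t) * t ^ γ) (Ioi 1) := by
    intro γ t ht
    have : (0:ℝ) < t := lt_trans one_pos ht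
    have := rpow_pos_of_pos hc γ
    simp only
    rw [mul_rpow hc.le (by linarith), rpow_neg hc.le]
    field_simp
  have hs : ∀ γ : ℝ, (∫ t in Ioi 1, w (c * t) * t ^ γ)⁻¹ =
      c * (c ^ γ * (∫ t in Ioi c, w t * t ^ γ)⁻¹) := by
    intro γ
    rw [← setIntegral_congr_fun measurableSet_Ioi (e γ), integral_const_mul,
      integral_comp_mul_left_Ioi (fun t => w t * t ^ γ) 1 hc, mul_one, smul_eq_mul, mul_inv,
      mul_inv, rpow_neg hc.le, inv_inv, inv_inv]
    ring
  have := vol_key (g := fun t => w (c * t)) (β₁ := β₁) (β := β) (β₂ := β₂) (l := l)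
    (fun t ht => hw _ (mul_pos hc (by linarith)))
    (by
      refine ⟨convex_Ioi 1, fun y hy z hz m n hm hn hmn => ?_⟩
      have hy' : c * y ∈ Ioi (0:ℝ) := mul_pos hc (lt_trans one_pos hy)
      have hz' : c * z ∈ Ioi (0:ℝ) := mul_pos hc (lt_trans one_pos hz)
      have := hlc.2 hy' hz' hm hn hmn
      simp only [smul_eq_mul] at this ⊢
      rw [show c * (m * y + n * z) = m * (c * y) + n * (c * z) by ring]
      exact this)
    (by
      intro γ hγ
      refine IntegrableOn.congr_fun ?_ (e γ) measurableSet_Ioi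
      refine Integrable.const_mul ?_ _
      refine (integrableOn_Ioi_comp_mul_left_iff (fun t => w t * t ^ γ) 1 hc).2 ?_
      exact (hint γ hγ).mono_set (Ioi_subset_Ioi (by linarith)))
    hdec hβ1 h1 h2 hl
  rw [hs, hs, hs] at this
  refine le_of_mul_le_mul_left ?_ hc
  linarith

lemma vol_mono {w : ℝ → ℝ} {s β₁ β β₂ l : ℝ} (hw : ∀ t, 0 < t → 0 < w t)
    (hlc : ConcaveOn ℝ (Ioi 0) (fun t => log (w t)))
    (hcont : ContinuousOn w (Ioi 0))
    (hint : ∀ γ : ℝ, -1 < γ → IntegrableOn (fun t => w t * t ^ γ) (Ioi 0))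
    (hdec : ∀ c, 0 < c → ∀ b a : ℝ, 0 < a → ∃ T, ∀ t, T ≤ t → w (c * t) * t ^ b < a)
    (hs : 0 < s)
    (hβ1 : -1 < β₁) (h1 : β₁ < β) (h2 : β < β₂) (hl : β = l * β₁ + (1 - l) * β₂) :
    log (∫ t in Ioi 0, w t * t ^ β) -
      (l * log (∫ t in Ioi 0, w t * t ^ β₁) + (1 - l) * log (∫ t in Ioi 0, w t * t ^ β₂)) ≤
    log (∫ t in Ioi s, w t * t ^ β) -
      (l * log (∫ t in Ioi s, w t * t ^ β₁) + (1 - l) * log (∫ t in Ioi s, w t * t ^ β₂)) := by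
  have pos : ∀ γ : ℝ, -1 < γ → ∀ c, 0 ≤ c → 0 < ∫ t in Ioi c, w t * t ^ γ := fun γ hγ c hc =>
    vol_int_pos (p := 0) ((hint γ hγ).mono_set (Ioi_subset_Ioi hc))
      (fun t ht _ => mul_pos (hw t (by linarith)) (rpow_pos_of_pos (by linarith) _))
  have eq : ∀ γ : ℝ, -1 < γ → ∀ c, 0 ≤ c → (∫ t in Ioi c, w t * t ^ γ) =
      (∫ t in Ioi 0, w t * t ^ γ) - ∫ t in (0:ℝ)..c, w t * t ^ γ := by
    intro γ hγ c hc
    have := intervalIntegral.integral_interval_add_Ioi (hint γ hγ)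
      ((hint γ hγ).mono_set (Ioi_subset_Ioi hc))
    linarith
  have cont : ∀ γ : ℝ, -1 < γ → ContinuousOn (fun c => ∫ t in Ioi c, w t * t ^ γ) (Icc 0 s) := by
    intro γ hγ
    have : ContinuousOn (fun c => (∫ t in Ioi 0, w t * t ^ γ) - ∫ t in (0:ℝ)..c, w t * t ^ γ)
        (Icc 0 s) := by
      refine continuousOn_const.sub ?_
      have := intervalIntegral.continuousOn_primitive_interval (a := 0) (b := s) (μ := volume)
        (f := fun t => w t * t ^ γ) (by
          rw [uIcc_of_le hs.le, integrableOn_Icc_iff_integrableOn_Ioc]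
          exact (hint γ hγ).mono_set Ioc_subset_Ioi_self)
      rwa [uIcc_of_le hs.le] at this
    exact this.congr (fun c hc => eq γ hγ c hc.1)
  have der : ∀ γ : ℝ, -1 < γ → ∀ c, 0 < c →
      HasDerivAt (fun c => ∫ t in Ioi c, w t * t ^ γ) (-(w c * c ^ γ)) c := by
    intro γ hγ c hc
    have cf : ContinuousOn (fun t => w t * t ^ γ) (Ioi 0) :=
      hcont.mul (fun t ht => (continuousAt_rpow_const t γ
        (Or.inl (ne_of_gt ht))).continuousWithinAt)
    have hd := intervalIntegral.integral_hasDerivAt_right (a := 0) (b := c)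
      (f := fun t => w t * t ^ γ)
      (by
        rw [intervalIntegrable_iff_integrableOn_Ioc_of_le hc.le]
        exact (hint γ hγ).mono_set Ioc_subset_Ioi_self)
      (cf.stronglyMeasurableAtFilter isOpen_Ioi c hc)
      (cf.continuousAt (Ioi_mem_nhds hc))
    have := hd.const_sub (∫ t in Ioi 0, w t * t ^ γ)
    refine this.congr_of_eventuallyEq ?_
    filter_upwards [Ioi_mem_nhds hc] with y hy
    exact eq γ hγ y (le_of_lt hy)
  have hβ : -1 < β := by linarith
  have hβ2 : -1 < β₂ := by linarith
  have clog : ∀ γ : ℝ, -1 < γ → ContinuousOn (fun c => log (∫ t in Ioi c, w t * t ^ γ)) (Icc 0 s) :=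
    fun γ hγ => (cont γ hγ).log (fun c hc => (pos γ hγ c hc.1).ne')
  set Φ : ℝ → ℝ := fun c => log (∫ t in Ioi c, w t * t ^ β) -
      (l * log (∫ t in Ioi c, w t * t ^ β₁) + (1 - l) * log (∫ t in Ioi c, w t * t ^ β₂)) with hΦ
  have dΦ : ∀ c, 0 < c → HasDerivAt Φ
      (-(w c * c ^ β) / (∫ t in Ioi c, w t * t ^ β) -
      (l * (-(w c * c ^ β₁) / (∫ t in Ioi c, w t * t ^ β₁)) +
        (1 - l) * (-(w c * c ^ β₂) / (∫ t in Ioi c, w t * t ^ β₂)))) c := by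
    intro c hc
    have L : ∀ γ : ℝ, -1 < γ → HasDerivAt (fun c => log (∫ t in Ioi c, w t * t ^ γ))
      (-(w c * c ^ γ) / (∫ t in Ioi c, w t * t ^ γ)) c :=
      fun γ hγ => (der γ hγ c hc).log (pos γ hγ c hc.le).ne'
    exact (L β hβ).sub (((L β₁ hβ1).const_mul l).add ((L β₂ hβ2).const_mul (1 - l)))
  have mono : MonotoneOn Φ (Icc 0 s) := by
    apply monotoneOn_of_deriv_nonneg (convex_Icc 0 s)
    · exact (clog β hβ).sub ((continuousOn_const.mul (clog β₁ hβ1)).add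
        (continuousOn_const.mul (clog β₂ hβ2)))
    · rw [interior_Icc]
      intro c hc
      exact (dΦ c hc.1).differentiableAt.differentiableWithinAt
    · rw [interior_Icc]
      intro c hc
      rw [(dΦ c hc.1).deriv]
      have k := vol_scaled hw hlc hint (hdec c hc.1) hc.1 hβ1 h1 h2 hl
      have k' := mul_le_mul_of_nonneg_left k (hw c hc.1).le
      simp only [div_eq_mul_inv]
      linarith
  exact mono (left_mem_Icc.2 hs.le) (right_mem_Icc.2 hs.le) hs.le

/-- the Volterra weight -/
noncomputable def volW (x α t : ℝ) : ℝ := x ^ (t + α) / Real.Gamma (t + α + 1)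

lemma volW_pos {x α : ℝ} (hx0 : 0 < x) (hα : 0 < α) (t : ℝ) (ht : 0 < t) : 0 < volW x α t :=
  div_pos (rpow_pos_of_pos hx0 _) (Gamma_pos_of_pos (by linarith))

lemma volW_le {x α z : ℝ} (hx0 : 0 < x) (hα : 0 < α) (hz : 0 < z)
    (hmin : ∀ y ∈ Set.Ioi (0 : ℝ), Real.Gamma z ≤ Real.Gamma y) (t : ℝ) (ht : 0 < t) :
    volW x α t ≤ x ^ α / Real.Gamma z * rexp (-(-log x) * t) := by
  have e : rexp (-(-log x) * t) = x ^ t := by rw [rpow_def_of_pos hx0, neg_neg]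
  have : volW x α t ≤ x ^ (t + α) / Real.Gamma z :=
    div_le_div_of_nonneg_left (rpow_pos_of_pos hx0 _).le (Gamma_pos_of_pos hz)
      (hmin _ (by simp only [mem_Ioi]; linarith))
  refine this.trans (le_of_eq ?_)
  rw [e, rpow_add hx0]
  ring

lemma volW_cont {x α : ℝ} (hx0 : 0 < x) (hα : 0 < α) : ContinuousOn (volW x α) (Ioi 0) := by
  intro t ht
  have ht' : 0 < t := ht
  apply ContinuousAt.continuousWithinAt
  have hG : ContinuousAt Real.Gamma (t + α + 1) :=
    (Real.differentiableAt_Gamma (fun m => by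
      have : (0:ℝ) ≤ m := Nat.cast_nonneg m
      intro h; linarith)).continuousAt
  have hG' : ContinuousAt (fun t => Real.Gamma (t + α + 1)) t :=
    ContinuousAt.comp (f := fun t => t + α + 1) hG (by fun_prop)
  have hx : ContinuousAt (fun t : ℝ => x ^ (t + α)) t :=
    ContinuousAt.comp (f := fun t => t + α) (continuousAt_const_rpow hx0.ne') (by fun_prop)
  exact hx.div hG' (Gamma_pos_of_pos (by linarith)).ne'

lemma volW_lc {x α : ℝ} (hx0 : 0 < x) (hα : 0 < α) :
    ConcaveOn ℝ (Ioi 0) (fun t => log (volW x α t)) := by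
  have e : ∀ t, 0 < t → log (volW x α t) = (t + α) * log x - log (Real.Gamma (t + α + 1)) := by
    intro t ht
    rw [volW, log_div (rpow_pos_of_pos hx0 _).ne' (Gamma_pos_of_pos (by linarith)).ne',
      log_rpow hx0]
  refine ⟨convex_Ioi 0, fun y hy z hz m n hm hn hmn => ?_⟩
  have hy' : 0 < y := hy
  have hz' : 0 < z := hz
  have hc : 0 < m * y + n * z := (convex_Ioi (0:ℝ)) hy hz hm hn hmn
  have := convexOn_log_Gamma.2 (show y + α + 1 ∈ Ioi (0:ℝ) by simp only [mem_Ioi]; linarith)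
    (show z + α + 1 ∈ Ioi (0:ℝ) by simp only [mem_Ioi]; linarith) hm hn hmn
  simp only [smul_eq_mul, Function.comp] at this ⊢
  rw [e y hy', e z hz', e _ hc]
  have hn' : n = 1 - m := by linarith
  rw [show m * (y + α + 1) + n * (z + α + 1) = m * y + n * z + α + 1 by rw [hn']; ring] at this
  rw [hn'] at this ⊢
  linarith

lemma volW_int {x α z : ℝ} (hx0 : 0 < x) (hx1 : x < 1) (hα : 0 < α) (hz : 0 < z)
    (hmin : ∀ y ∈ Set.Ioi (0 : ℝ), Real.Gamma z ≤ Real.Gamma y) (γ : ℝ) (hγ : -1 < γ) :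
    IntegrableOn (fun t => volW x α t * t ^ γ) (Ioi 0) := by
  have h := (integrableOn_rpow_mul_exp_neg_mul_rpow (p := 1) hγ one_pos
    (show 0 < -log x by linarith [log_neg hx0 hx1])).const_mul (x ^ α / Real.Gamma z)
  refine Integrable.mono' h ?_ ?_
  · refine ContinuousOn.aestronglyMeasurable ?_ measurableSet_Ioi
    exact (volW_cont hx0 hα).mul (fun t ht => (continuousAt_rpow_const t γ
        (Or.inl (ne_of_gt ht))).continuousWithinAt)
  · filter_upwards [ae_restrict_mem measurableSet_Ioi] with t ht
    have ht' : 0 < t := ht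
    have p := rpow_pos_of_pos ht' γ
    rw [norm_of_nonneg (mul_pos (volW_pos hx0 hα t ht') p).le, rpow_one]
    have := mul_le_mul_of_nonneg_right (volW_le hx0 hα hz hmin t ht') p.le
    linarith

lemma volW_dec {x α z : ℝ} (hx0 : 0 < x) (hx1 : x < 1) (hα : 0 < α) (hz : 0 < z)
    (hmin : ∀ y ∈ Set.Ioi (0 : ℝ), Real.Gamma z ≤ Real.Gamma y) (c : ℝ) (hc : 0 < c)
    (b a : ℝ) (ha : 0 < a) : ∃ T, ∀ t, T ≤ t → volW x α (c * t) * t ^ b < a := by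
  have hk : 0 < -log x * c := mul_pos (by linarith [log_neg hx0 hx1]) hc
  have h := (tendsto_rpow_mul_exp_neg_mul_atTop_nhds_zero b _ hk).const_mul (x ^ α / Real.Gamma z)
  rw [mul_zero] at h
  have h2 := (h.eventually_lt_const ha).and (Filter.eventually_gt_atTop (0:ℝ))
  obtain ⟨T, hT⟩ := Filter.eventually_atTop.1 h2
  refine ⟨T, fun t ht => ?_⟩
  obtain ⟨u, t0⟩ := hT t ht
  refine lt_of_le_of_lt ?_ u
  have := mul_le_mul_of_nonneg_right (volW_le hx0 hα hz hmin (c * t) (mul_pos hc t0))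
    (rpow_pos_of_pos t0 b).le
  refine this.trans (le_of_eq ?_)
  rw [show -(-log x) * (c * t) = -(-log x * c) * t by ring]
  ring

lemma volG_eq {x α s β : ℝ} (hβ : -1 < β) : volterraG β x α s =
    (∫ t in Ioi s, volW x α t * t ^ β) / ∫ t in Ioi 0, volW x α t * t ^ β := by
  have hG : Real.Gamma (β + 1) ≠ 0 := (Gamma_pos_of_pos (by linarith)).ne'
  have e : ∀ c : ℝ, (∫ t in Ioi c,
      x ^ (t + α) * t ^ β / (Real.Gamma (t + α + 1) * Real.Gamma (β + 1))) =
      (∫ t in Ioi c, volW x α t * t ^ β) * (Real.Gamma (β + 1))⁻¹ := by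
    intro c
    rw [← integral_mul_const]
    congr 1
    funext t
    simp only [volW, div_eq_mul_inv, mul_inv]
    ring
  rw [volterraG, volterraMuInc, volterraMu, e, e, mul_div_mul_right _ _ (inv_ne_zero hG)]

lemma volG_lt (x α s z : ℝ)
    (hx0 : 0 < x) (hx1 : x < 1) (hs : 0 < s) (hz : 0 < z)
    (hmin : ∀ y ∈ Set.Ioi (0 : ℝ), Real.Gamma z ≤ Real.Gamma y)
    (hα : 0 < α) (β₁ β₂ : ℝ) (hβ1 : -1 < β₁) (h12 : β₁ < β₂) (l : ℝ) (hl0 : 0 < l) (hl1 : l < 1) :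
      volterraG β₁ x α s ^ l * volterraG β₂ x α s ^ (1 - l) ≤
        volterraG (l * β₁ + (1 - l) * β₂) x α s := by
  obtain ⟨β, hβ⟩ : ∃ β, β = l * β₁ + (1 - l) * β₂ := ⟨_, rfl⟩
  rw [← hβ]
  have h1 : β₁ < β := by rw [hβ]; nlinarith
  have h2 : β < β₂ := by rw [hβ]; nlinarith
  have m := vol_mono (volW_pos hx0 hα) (volW_lc hx0 hα) (volW_cont hx0 hα)
    (volW_int hx0 hx1 hα hz hmin) (volW_dec hx0 hx1 hα hz hmin) hs hβ1 h1 h2 hβ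
  have pos : ∀ γ : ℝ, -1 < γ → ∀ c, 0 ≤ c → 0 < ∫ t in Ioi c, volW x α t * t ^ γ :=
    fun γ hγ c hc =>
    vol_int_pos (p := 0) ((volW_int hx0 hx1 hα hz hmin γ hγ).mono_set (Ioi_subset_Ioi hc))
      (fun t ht _ => mul_pos (volW_pos hx0 hα t (by linarith)) (rpow_pos_of_pos (by linarith) _))
  have gpos : ∀ γ : ℝ, -1 < γ → 0 < volterraG γ x α s := by
    intro γ hγ
    rw [volG_eq hγ]
    exact div_pos (pos γ hγ s hs.le) (pos γ hγ 0 le_rfl)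
  have glog : ∀ γ : ℝ, -1 < γ → log (volterraG γ x α s) =
      log (∫ t in Ioi s, volW x α t * t ^ γ) - log (∫ t in Ioi 0, volW x α t * t ^ γ) := by
    intro γ hγ
    rw [volG_eq hγ, log_div (pos γ hγ s hs.le).ne' (pos γ hγ 0 le_rfl).ne']
  have g1 := gpos β₁ hβ1
  have g2 := gpos β₂ (by linarith)
  have g0 := gpos β (by linarith)
  have q1 := rpow_pos_of_pos g1 l
  have q2 := rpow_pos_of_pos g2 (1 - l)
  rw [← log_le_log_iff (mul_pos q1 q2) g0, log_mul q1.ne' q2.ne', log_rpow g1, log_rpow g2,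
    glog _ hβ1, glog β₂ (by linarith), glog β (by linarith)]
  linarith

/-- For `0 < x < 1`, `s > 0` and `α > z*` (`z*` the abscissa of the minimum of the
gamma function on `(0, ∞)`), the function `β ↦ G_β(x, α, s)` is log-concave on
`(-1, ∞)`. -/
theorem volterraG_logConcave_in_beta (x α s zstar : ℝ)
    (hx0 : 0 < x) (hx1 : x < 1) (hs : 0 < s)
    (hzstar : zstar ∈ Set.Ioi (0 : ℝ))
    (hmin : ∀ y ∈ Set.Ioi (0 : ℝ), Real.Gamma zstar ≤ Real.Gamma y)
    (hα : zstar < α) :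
    ∀ β₁ β₂ : ℝ, -1 < β₁ → -1 < β₂ → ∀ l : ℝ, l ∈ Set.Icc (0 : ℝ) 1 →
      volterraG β₁ x α s ^ l * volterraG β₂ x α s ^ (1 - l) ≤
        volterraG (l * β₁ + (1 - l) * β₂) x α s := by
  intro β₁ β₂ hβ1 hβ2 l hl
  have hz : 0 < zstar := hzstar
  have hα0 : 0 < α := hz.trans hα
  rcases hl.1.eq_or_lt with h | hl0
  · rw [← h]; simp
  rcases hl.2.eq_or_lt with h | hl1
  · rw [h]; simp
  rcases lt_trichotomy β₁ β₂ with h | h | h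
  · exact volG_lt x α s zstar hx0 hx1 hs hz hmin hα0 β₁ β₂ hβ1 h l hl0 hl1
  · subst h
    have e : l * β₁ + (1 - l) * β₁ = β₁ := by ring
    have g0 : 0 < volterraG β₁ x α s := by
      have pos : ∀ c, 0 ≤ c → 0 < ∫ t in Ioi c, volW x α t * t ^ β₁ :=
        fun c hc =>
        vol_int_pos (p := 0)
          ((volW_int hx0 hx1 hα0 hz hmin β₁ hβ1).mono_set (Ioi_subset_Ioi hc))
          (fun t ht _ => mul_pos (volW_pos hx0 hα0 t (by linarith))
            (rpow_pos_of_pos (by linarith) _))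
      rw [volG_eq hβ1]
      exact div_pos (pos s hs.le) (pos 0 le_rfl)
    rw [e, ← rpow_add g0]
    simp
  · have := volG_lt x α s zstar hx0 hx1 hs hz hmin hα0 β₂ β₁ hβ2 h (1 - l) (by linarith)
      (by linarith)
    rw [sub_sub_cancel] at this
    rw [mul_comm, add_comm]
    exact this
end

section
/- Let 0 < x < 1, s > 0, β > -1, and let α > z*, where z* ≈ 1.461632144 is the abscissa of the minimum of the gamma function on (0, ∞) (equivalently, Γ is strictly increasing on [z*, ∞)). Then the Turán-type inequality G_{β+1}(x, α, s)² − G_β(x, α, s) · G_{β+2}(x, α, s) ≥ 0 holds. -/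
open MeasureTheory Real Set

/-- A positive integrable function has positive integral over a half-line. -/
theorem vt_pos (g : ℝ → ℝ) (s : ℝ) (hg : ∀ t, s < t → 0 < g t)
    (hi : IntegrableOn g (Ioi s)) : 0 < ∫ t in Ioi s, g t := by
  rw [setIntegral_pos_iff_support_of_nonneg_ae _ hi]
  · have : Function.support g ∩ Ioi s = Ioi s := by
      apply inter_eq_right.2
      intro t ht
      exact (hg t ht).ne'
    rw [this]; simp
  · refine (ae_restrict_iff' measurableSet_Ioi).2 (Filter.Eventually.of_forall ?_)
    intro t ht
    exact (hg t ht).le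

theorem vt_key (f θ : ℝ → ℝ) (hf : ∀ t, 0 < t → 0 < f t) (hθ : MonotoneOn θ (Ioi 0))
    (hd : ∀ t, 0 < t → HasDerivAt f (-θ t * f t / t) t)
    (h0 : IntegrableOn f (Ioi 0)) (h1 : IntegrableOn (fun t => t * f t) (Ioi 0))
    (h2 : IntegrableOn (fun t => t ^ 2 * f t) (Ioi 0)) (s : ℝ) (hs : 0 < s) :
    0 ≤ (∫ t in Ioi s, t * f t) * (∫ t in Ioi s, t ^ 2 * f t)
      - 2 * s * (∫ t in Ioi s, f t) * (∫ t in Ioi s, t ^ 2 * f t)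
      + s ^ 2 * (∫ t in Ioi s, f t) * (∫ t in Ioi s, t * f t) := by
  have hsub : Ioi s ⊆ Ioi (0 : ℝ) := Ioi_subset_Ioi hs.le
  have k0 := h0.mono_set hsub
  have k1 := h1.mono_set hsub
  have k2 := h2.mono_set hsub
  -- integral of a quadratic times f
  have quad : ∀ A B C : ℝ,
      IntegrableOn (fun t => A * (t ^ 2 * f t) + B * (t * f t) + C * f t) (Ioi s) ∧
      ∫ t in Ioi s, (A * (t ^ 2 * f t) + B * (t * f t) + C * f t)
        = A * (∫ t in Ioi s, t ^ 2 * f t) + B * (∫ t in Ioi s, t * f t)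
          + C * (∫ t in Ioi s, f t) := by
    intro A B C
    have i2 := k2.const_mul A
    have i1 := k1.const_mul B
    have i0 := k0.const_mul C
    refine ⟨(i2.add i1).add i0, ?_⟩
    rw [integral_add (f := fun t => A * (t ^ 2 * f t) + B * (t * f t)) (i2.add i1) i0,
      integral_add i2 i1, integral_const_mul, integral_const_mul, integral_const_mul]
  have D1 := vt_pos _ s (fun t ht => by
    have : 0 < (t - s) * f t := mul_pos (sub_pos.2 ht) (hf t (hs.trans ht))
    linarith) (quad 0 1 (-s)).1
  rw [(quad 0 1 (-s)).2] at D1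
  have D2 := vt_pos _ s (fun t ht => by
    have : 0 < (t - s) ^ 2 * f t := mul_pos (pow_pos (sub_pos.2 ht) 2) (hf t (hs.trans ht))
    linarith) (quad 1 (-2 * s) (s ^ 2)).1
  rw [(quad 1 (-2 * s) (s ^ 2)).2] at D2
  set I0 := ∫ t in Ioi s, f t with hI0
  set I1 := ∫ t in Ioi s, t * f t with hI1
  set I2 := ∫ t in Ioi s, t ^ 2 * f t with hI2
  have D1' : 0 < I1 - s * I0 := by linarith
  obtain ⟨a, ha⟩ : ∃ a, a = (I2 - s * I1) / (I1 - s * I0) := ⟨_, rfl⟩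
  have ha' : a * (I1 - s * I0) = I2 - s * I1 := by
    rw [ha]; field_simp
  have has : s ≤ a := by
    rw [ha, le_div_iff₀ D1']; nlinarith
  have ha0 : 0 < a := hs.trans_le has
  set c := θ a with hc
  obtain ⟨qi, qe⟩ := quad (3 - c) (-2 * (a + s) + c * (a + s)) (a * s - c * (a * s))
  have hnn : ∀ R, a ≤ R → 0 ≤ ∫ t in s..R, ((3 - c) * (t ^ 2 * f t)
      + (-2 * (a + s) + c * (a + s)) * (t * f t) + (a * s - c * (a * s)) * f t) := by
    intro R hR
    have hder : ∀ t, 0 < t → HasDerivAt (fun t => (t * ((t - a) * (t - s))) * f t)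
        ((3 * t ^ 2 - 2 * (a + s) * t + a * s) * f t - (t - a) * (t - s) * θ t * f t) t := by
      intro t ht
      have e := ((hasDerivAt_id t).mul (((hasDerivAt_id t).sub_const a).mul
        ((hasDerivAt_id t).sub_const s))).mul (hd t ht)
      refine e.congr_deriv ?_
      simp only [id, Pi.mul_apply]
      field_simp
      ring
    have := intervalIntegral.sub_le_integral_of_hasDeriv_right_of_le
      (g := fun t => (t * ((t - a) * (t - s))) * f t)
      (g' := fun t => (3 * t ^ 2 - 2 * (a + s) * t + a * s) * f t - (t - a) * (t - s) * θ t * f t)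
      (φ := fun t => (3 - c) * (t ^ 2 * f t)
      + (-2 * (a + s) + c * (a + s)) * (t * f t) + (a * s - c * (a * s)) * f t)
      (has.trans hR)
      (fun t ht => (hder t (hs.trans_le ht.1)).continuousAt.continuousWithinAt)
      (fun t ht => (hder t (hs.trans ht.1)).hasDerivWithinAt)
      ((integrableOn_Icc_iff_integrableOn_Ioc (by simp)).2 (qi.mono_set Ioc_subset_Ioi_self))
      (by
        intro t ht
        have ht0 : 0 < t := hs.trans ht.1
        have h : 0 ≤ (t - a) * (θ t - c) := by
          rcases le_total t a with h | h
          · exact mul_nonneg_of_nonpos_of_nonpos (by linarith)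
              (by have := hθ (mem_Ioi.2 ht0) (mem_Ioi.2 ha0) h; linarith)
          · exact mul_nonneg (by linarith)
              (by have := hθ (mem_Ioi.2 ha0) (mem_Ioi.2 ht0) h; linarith)
        have h' : 0 ≤ (t - a) * (θ t - c) * ((t - s) * f t) :=
          mul_nonneg h (mul_nonneg (by linarith [ht.1]) (hf t ht0).le)
        linarith)
    have hRnn : 0 ≤ (R * ((R - a) * (R - s))) * f R := by
      have hR0 : 0 < R := ha0.trans_le hR
      exact mul_nonneg (mul_nonneg hR0.le (mul_nonneg (by linarith) (by linarith))) (hf R hR0).le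
    simp only [sub_self, mul_zero, zero_mul, sub_zero] at this
    linarith
  have hlim := ge_of_tendsto (intervalIntegral_tendsto_integral_Ioi s qi Filter.tendsto_id)
    (Filter.eventually_atTop.2 ⟨a, hnn⟩)
  rw [qe] at hlim
  have h3 : 0 ≤ 2 * I2 - (a + s) * I1 := by
    have : (3 - c) * I2 + (-2 * (a + s) + c * (a + s)) * I1 + (a * s - c * (a * s)) * I0
        = 2 * I2 - (a + s) * I1 := by linear_combination (c - 1) * ha'
    linarith
  have h4 := mul_nonneg h3 D1'.le
  have h5 : a * I1 * (I1 - s * I0) = (I2 - s * I1) * I1 := by rw [← ha']; ring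
  linarith

theorem vt_prim (g : ℝ → ℝ) (hc : ContinuousOn g (Ioi 0)) (hi : IntegrableOn g (Ioi 0)) :
    (∀ b, 0 < b → ContinuousOn (fun s => ∫ t in Ioi s, g t) (Icc 0 b)) ∧
    (∀ s, 0 < s → HasDerivAt (fun s => ∫ t in Ioi s, g t) (-g s) s) := by
  have e : ∀ s, 0 ≤ s → ∫ t in Ioi s, g t = (∫ t in Ioi 0, g t) - ∫ t in (0 : ℝ)..s, g t := by
    intro s hs
    have := intervalIntegral.integral_interval_add_Ioi hi (hi.mono_set (Ioi_subset_Ioi hs))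
    linarith
  have hI : ∀ b : ℝ, IntegrableOn g (Icc 0 b) := fun b =>
    (integrableOn_Icc_iff_integrableOn_Ioc (by simp)).2 (hi.mono_set Ioc_subset_Ioi_self)
  constructor
  · intro b hb
    have h := intervalIntegral.continuousOn_primitive_interval (a := 0) (b := b) (f := g)
      (μ := volume) (by rw [uIcc_of_le hb.le]; exact hI b)
    rw [uIcc_of_le hb.le] at h
    exact (continuousOn_const.sub h).congr (fun s hs => e s hs.1)
  · intro s hs
    have h := intervalIntegral.integral_hasDerivAt_right (a := 0) (b := s) (f := g)
      (IntegrableOn.intervalIntegrable (by rw [uIcc_of_le hs.le]; exact hI s))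
      (hc.stronglyMeasurableAtFilter isOpen_Ioi s hs)
      (hc.continuousAt (Ioi_mem_nhds hs))
    refine ((h.const_sub (∫ t in Ioi 0, g t))).congr_of_eventuallyEq ?_
    filter_upwards [Ioi_mem_nhds hs] with u hu
    exact e u (le_of_lt hu)

theorem vt_main (f θ : ℝ → ℝ) (hf : ∀ t, 0 < t → 0 < f t) (hθ : MonotoneOn θ (Ioi 0))
    (hd : ∀ t, 0 < t → HasDerivAt f (-θ t * f t / t) t)
    (h0 : IntegrableOn f (Ioi 0)) (h1 : IntegrableOn (fun t => t * f t) (Ioi 0))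
    (h2 : IntegrableOn (fun t => t ^ 2 * f t) (Ioi 0)) (s : ℝ) (hs : 0 < s) :
    (∫ t in Ioi 0, t * f t) ^ 2 / ((∫ t in Ioi 0, f t) * (∫ t in Ioi 0, t ^ 2 * f t)) ≤
    (∫ t in Ioi s, t * f t) ^ 2 / ((∫ t in Ioi s, f t) * (∫ t in Ioi s, t ^ 2 * f t)) := by
  have hc : ContinuousOn f (Ioi 0) := fun t ht => (hd t ht).continuousAt.continuousWithinAt
  obtain ⟨c0, d0⟩ := vt_prim f hc h0
  obtain ⟨c1, d1⟩ := vt_prim _ (continuousOn_id.mul hc) h1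
  obtain ⟨c2, d2⟩ := vt_prim _ ((continuousOn_id.pow 2).mul hc) h2
  have p0 : ∀ u : ℝ, 0 ≤ u → 0 < ∫ t in Ioi u, f t := fun u hu =>
    vt_pos _ u (fun t ht => hf t (hu.trans_lt ht)) (h0.mono_set (Ioi_subset_Ioi hu))
  have p1 : ∀ u : ℝ, 0 ≤ u → 0 < ∫ t in Ioi u, t * f t := fun u hu =>
    vt_pos _ u (fun t ht => mul_pos (hu.trans_lt ht) (hf t (hu.trans_lt ht)))
      (h1.mono_set (Ioi_subset_Ioi hu))
  have p2 : ∀ u : ℝ, 0 ≤ u → 0 < ∫ t in Ioi u, t ^ 2 * f t := fun u hu =>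
    vt_pos _ u (fun t ht => mul_pos (pow_pos (hu.trans_lt ht) 2) (hf t (hu.trans_lt ht)))
      (h2.mono_set (Ioi_subset_Ioi hu))
  have hD : ∀ u : ℝ, 0 < u → HasDerivAt (fun u => (∫ t in Ioi u, t * f t) ^ 2 /
      ((∫ t in Ioi u, f t) * (∫ t in Ioi u, t ^ 2 * f t)))
      ((∫ t in Ioi u, t * f t) * f u *
        ((∫ t in Ioi u, t * f t) * (∫ t in Ioi u, t ^ 2 * f t)
      - 2 * u * (∫ t in Ioi u, f t) * (∫ t in Ioi u, t ^ 2 * f t)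
      + u ^ 2 * (∫ t in Ioi u, f t) * (∫ t in Ioi u, t * f t)) /
      ((∫ t in Ioi u, f t) * (∫ t in Ioi u, t ^ 2 * f t)) ^ 2) u := by
    intro u hu
    have := ((d1 u hu).pow 2).div ((d0 u hu).mul (d2 u hu))
      (mul_pos (p0 u hu.le) (p2 u hu.le)).ne'
    refine this.congr_deriv ?_
    simp only [id, Pi.mul_apply, Pi.pow_apply]
    congr 1
    ring
  have hmono : MonotoneOn (fun u => (∫ t in Ioi u, t * f t) ^ 2 /
      ((∫ t in Ioi u, f t) * (∫ t in Ioi u, t ^ 2 * f t))) (Icc 0 s) := by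
    apply monotoneOn_of_deriv_nonneg (convex_Icc 0 s)
    · exact ((c1 s hs).pow 2).div ((c0 s hs).mul (c2 s hs))
        (fun u hu => (mul_pos (p0 u hu.1) (p2 u hu.1)).ne')
    · rw [interior_Icc]
      intro u hu
      exact (hD u hu.1).differentiableAt.differentiableWithinAt
    · rw [interior_Icc]
      intro u hu
      rw [(hD u hu.1).deriv]
      exact div_nonneg (mul_nonneg (mul_nonneg (p1 u hu.1.le).le (hf u hu.1).le)
        (vt_key f θ hf hθ hd h0 h1 h2 u hu.1)) (sq_nonneg _)
  exact hmono ⟨le_rfl, hs.le⟩ ⟨hs.le, le_rfl⟩ hs.le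

/-- The logarithmic derivative of the gamma function on the positive axis. -/
theorem vt_digamma (z : ℝ) (hz : 0 < z) (hmin : ∀ y ∈ Set.Ioi (0 : ℝ), Real.Gamma z ≤ Real.Gamma y) :
    MonotoneOn (deriv (Real.log ∘ Real.Gamma)) (Ioi 0) ∧
    (∀ y, 0 < y → HasDerivAt Real.Gamma (Real.Gamma y * deriv (Real.log ∘ Real.Gamma) y) y) ∧
    (∀ y, z ≤ y → 0 ≤ deriv (Real.log ∘ Real.Gamma) y) := by
  have hdG : ∀ y : ℝ, 0 < y → DifferentiableAt ℝ Real.Gamma y := fun y hy =>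
    Real.differentiableAt_Gamma (fun m => by have : (0 : ℝ) ≤ m := m.cast_nonneg
                                             linarith)
  have hL : ∀ y : ℝ, 0 < y → HasDerivAt (Real.log ∘ Real.Gamma)
      (deriv Real.Gamma y / Real.Gamma y) y := fun y hy =>
    (hdG y hy).hasDerivAt.log (Real.Gamma_pos_of_pos hy).ne'
  have hm : MonotoneOn (deriv (Real.log ∘ Real.Gamma)) (Ioi 0) :=
    Real.convexOn_log_Gamma.monotoneOn_deriv (fun y hy => (hL y hy).differentiableAt)
  refine ⟨hm, ?_, ?_⟩
  · intro y hy
    refine (hdG y hy).hasDerivAt.congr_deriv ?_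
    rw [(hL y hy).deriv]
    have := (Real.Gamma_pos_of_pos hy).ne'
    field_simp
  · intro y hy
    have hz0 : deriv Real.Gamma z = 0 := by
      apply IsLocalMin.deriv_eq_zero
      filter_upwards [Ioi_mem_nhds hz] with u hu using hmin u hu
    have := hm (mem_Ioi.2 hz) (mem_Ioi.2 (hz.trans_le hy)) hy
    rwa [(hL z hz).deriv, hz0, zero_div] at this

theorem vt_int (x α γ z : ℝ) (hx0 : 0 < x) (hx1 : x < 1) (hγ : -1 < γ) (hz : 0 < z)
    (hmin : ∀ y ∈ Set.Ioi (0 : ℝ), Real.Gamma z ≤ Real.Gamma y) (hα : 0 < α) :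
    IntegrableOn (fun t => x ^ (t + α) * t ^ γ / Real.Gamma (t + α + 1)) (Ioi 0) := by
  have hb : 0 < -Real.log x := neg_pos.2 (Real.log_neg hx0 hx1)
  have h := (integrableOn_rpow_mul_exp_neg_mul_rpow hγ one_pos hb).const_mul
    (x ^ α / Real.Gamma z)
  have hGz := Real.Gamma_pos_of_pos hz
  refine Integrable.mono' h ?_ ?_
  · refine ContinuousOn.aestronglyMeasurable ?_ measurableSet_Ioi
    intro t ht
    have ht : 0 < t := ht
    have hp : 0 < t + α + 1 := by linarith
    have hG : ContinuousAt (fun t => Real.Gamma (t + α + 1)) t :=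
      ContinuousAt.comp (f := fun t => t + α + 1) (g := Real.Gamma)
        ((vt_digamma z hz hmin).2.1 _ hp).continuousAt (by fun_prop)
    refine ContinuousAt.continuousWithinAt (ContinuousAt.div (ContinuousAt.mul ?_ ?_) hG
      (Real.Gamma_pos_of_pos hp).ne')
    · exact ContinuousAt.rpow continuousAt_const (by fun_prop) (Or.inl hx0.ne')
    · exact continuousAt_id.rpow_const (Or.inl ht.ne')
  · refine (ae_restrict_iff' measurableSet_Ioi).2 (Filter.Eventually.of_forall ?_)
    intro t ht
    have ht : 0 < t := ht
    have hp : 0 < t + α + 1 := by linarith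
    have hG := Real.Gamma_pos_of_pos hp
    have e : x ^ α / Real.Gamma z * (t ^ γ * Real.exp (- -Real.log x * t ^ (1 : ℝ)))
        = x ^ (t + α) * t ^ γ / Real.Gamma z := by
      rw [Real.rpow_one, neg_neg, ← Real.rpow_def_of_pos hx0, Real.rpow_add hx0]
      ring
    have hn : 0 ≤ x ^ (t + α) * t ^ γ :=
      mul_nonneg (Real.rpow_nonneg hx0.le _) (Real.rpow_nonneg ht.le _)
    rw [e, Real.norm_of_nonneg (div_nonneg hn hG.le)]
    exact div_le_div_of_nonneg_left hn hGz (hmin _ hp)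

/-- Turán type inequality for the normalized incomplete Volterra function `G_β`. -/
theorem volterraG_turan (x α s β zstar : ℝ)
    (hx0 : 0 < x) (hx1 : x < 1) (hs : 0 < s) (hβ : -1 < β)
    (hzstar : zstar ∈ Set.Ioi (0 : ℝ))
    (hmin : ∀ y ∈ Set.Ioi (0 : ℝ), Real.Gamma zstar ≤ Real.Gamma y)
    (hα : zstar < α) :
    0 ≤ volterraG (β + 1) x α s ^ 2 -
      volterraG β x α s * volterraG (β + 2) x α s := by
  have hz : 0 < zstar := hzstar
  have hα0 : 0 < α := hz.trans hα
  obtain ⟨hψm, hΓ, hψ0⟩ := vt_digamma zstar hz hmin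
  set ψ := deriv (Real.log ∘ Real.Gamma) with hψ
  obtain ⟨f, hf⟩ : ∃ f : ℝ → ℝ, f = fun t => x ^ (t + α) * t ^ β / Real.Gamma (t + α + 1) :=
    ⟨_, rfl⟩
  have hfpos : ∀ t, 0 < t → 0 < f t := by
    intro t ht
    rw [hf]
    exact div_pos (mul_pos (Real.rpow_pos_of_pos hx0 _) (Real.rpow_pos_of_pos ht _))
      (Real.Gamma_pos_of_pos (by linarith))
  have e1 : ∀ t, 0 < t → x ^ (t + α) * t ^ (β + 1) / Real.Gamma (t + α + 1) = t * f t := by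
    intro t ht
    rw [hf, Real.rpow_add ht, Real.rpow_one]; ring
  have e2 : ∀ t, 0 < t → x ^ (t + α) * t ^ (β + 2) / Real.Gamma (t + α + 1) = t ^ 2 * f t := by
    intro t ht
    rw [hf, Real.rpow_add ht, Real.rpow_two]; ring
  have h0 : IntegrableOn f (Ioi 0) := by
    rw [hf]; exact vt_int x α β zstar hx0 hx1 hβ hz hmin hα0
  have h1 : IntegrableOn (fun t => t * f t) (Ioi 0) :=
    (vt_int x α (β + 1) zstar hx0 hx1 (by linarith) hz hmin hα0).congr_fun
      (fun t ht => e1 t ht) measurableSet_Ioi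
  have h2 : IntegrableOn (fun t => t ^ 2 * f t) (Ioi 0) :=
    (vt_int x α (β + 2) zstar hx0 hx1 (by linarith) hz hmin hα0).congr_fun
      (fun t ht => e2 t ht) measurableSet_Ioi
  have hlog := Real.log_neg hx0 hx1
  have hθ : MonotoneOn (fun t => -β + t * (ψ (t + α + 1) - Real.log x)) (Ioi 0) := by
    intro t ht u hu htu
    have ht : 0 < t := ht
    have hu : 0 < u := hu
    have hm : ψ (t + α + 1) ≤ ψ (u + α + 1) :=
      hψm (mem_Ioi.2 (by linarith)) (mem_Ioi.2 (by linarith)) (by linarith)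
    have hn : 0 ≤ ψ (t + α + 1) := hψ0 _ (by linarith)
    have := mul_le_mul htu (sub_le_sub_right hm (Real.log x)) (by linarith) hu.le
    simpa using this
  have hd : ∀ t, 0 < t →
      HasDerivAt f (-(-β + t * (ψ (t + α + 1) - Real.log x)) * f t / t) t := by
    intro t ht
    have hp : 0 < t + α + 1 := by linarith
    have hG := Real.Gamma_pos_of_pos hp
    have g1 : HasDerivAt (fun t => x ^ (t + α)) (Real.log x * 1 * x ^ (t + α)) t :=
      ((hasDerivAt_id t).add_const α).const_rpow hx0
    have g2 : HasDerivAt (fun t : ℝ => t ^ β) (β * t ^ (β - 1)) t :=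
      Real.hasDerivAt_rpow_const (Or.inl ht.ne')
    have g3 : HasDerivAt (fun t => Real.Gamma (t + α + 1))
        (Real.Gamma (t + α + 1) * ψ (t + α + 1) * 1) t :=
      HasDerivAt.comp t (hΓ _ hp) (((hasDerivAt_id t).add_const α).add_const 1)
    have := (g1.mul g2).div g3 hG.ne'
    rw [hf]
    refine this.congr_deriv ?_
    rw [Real.rpow_sub_one ht.ne']
    simp only [Pi.mul_apply]
    field_simp
    ring
  have hmain := vt_main f _ hfpos hθ hd h0 h1 h2 s hs
  -- rewriting the normalized functions
  have hG : ∀ (γ : ℝ) (g : ℝ → ℝ), -1 < γ →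
      (∀ t, 0 < t → x ^ (t + α) * t ^ γ / Real.Gamma (t + α + 1) = g t) →
      volterraG γ x α s = (∫ t in Ioi s, g t) / (∫ t in Ioi 0, g t) := by
    intro γ g hγ hg
    have hI : ∀ u : ℝ, 0 ≤ u → ∫ t in Ioi u,
        x ^ (t + α) * t ^ γ / (Real.Gamma (t + α + 1) * Real.Gamma (γ + 1))
        = (∫ t in Ioi u, g t) / Real.Gamma (γ + 1) := by
      intro u hu
      rw [← integral_div]
      refine setIntegral_congr_fun measurableSet_Ioi (fun t ht => ?_)
      rw [← hg t (hu.trans_lt ht), div_div]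
    unfold volterraG volterraMuInc volterraMu
    rw [hI s hs.le, hI 0 le_rfl,
      div_div_div_cancel_right₀ (Real.Gamma_pos_of_pos (by linarith)).ne']
  rw [hG β f hβ (fun t _ => by rw [hf]), hG (β + 1) _ (by linarith) e1,
    hG (β + 2) _ (by linarith) e2]
  have p0 : ∀ u : ℝ, 0 ≤ u → 0 < ∫ t in Ioi u, f t := fun u hu =>
    vt_pos _ u (fun t ht => hfpos t (hu.trans_lt ht)) (h0.mono_set (Ioi_subset_Ioi hu))
  have p1 : ∀ u : ℝ, 0 ≤ u → 0 < ∫ t in Ioi u, t * f t := fun u hu =>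
    vt_pos _ u (fun t ht => mul_pos (hu.trans_lt ht) (hfpos t (hu.trans_lt ht)))
      (h1.mono_set (Ioi_subset_Ioi hu))
  have p2 : ∀ u : ℝ, 0 ≤ u → 0 < ∫ t in Ioi u, t ^ 2 * f t := fun u hu =>
    vt_pos _ u (fun t ht => mul_pos (pow_pos (hu.trans_lt ht) 2) (hfpos t (hu.trans_lt ht)))
      (h2.mono_set (Ioi_subset_Ioi hu))
  have a0 := p0 s hs.le
  have a1 := p1 s hs.le
  have a2 := p2 s hs.le
  have b0 := p0 0 le_rfl
  have b1 := p1 0 le_rfl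
  have b2 := p2 0 le_rfl
  rw [div_le_div_iff₀ (mul_pos b0 b2) (mul_pos a0 a2)] at hmain
  rw [sub_nonneg, div_pow, div_mul_div_comm, div_le_div_iff₀ (mul_pos b0 b2) (pow_pos b1 2)]
  linarith
end

section
/- Let 0 < x < 1, s > 0, and let α > z*, where z* ≈ 1.461632144 is the abscissa of the minimum of the gamma function on (0, ∞). Let β₁, β₂ > -1 with β₁ ≠ β₂, λ ∈ (0, 1), and r ≤ 0. Then the weighted power-mean inequality M_r(G_{β₁}(x, α, s), G_{β₂}(x, α, s); λ) ≤ G_{λβ₁+(1-λ)β₂}(x, α, s) holds, where M_r(a, b; λ) = (λ a^r + (1-λ) b^r)^(1/r) for r < 0 and M_0(a, b; λ) = a^λ b^(1-λ). -/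
open MeasureTheory Real Set

/-- Weighted power mean of order `r` of `a, b` with weight `l`. -/
noncomputable def powerMean (r a b l : ℝ) : ℝ :=
  if r = 0 then a ^ l * b ^ (1 - l) else (l * a ^ r + (1 - l) * b ^ r) ^ (1 / r)


lemma vg_interp (p q g1 g2 : ℝ) (hp : 0 < p) (hpq : p ≤ q) (h1 : 0 < g1) (h2 : 0 < g2) :
    ∃ m n : ℝ, ∀ t : ℝ, 0 < t → (p ≤ t → t ≤ q → m * t ^ (-g1) + n * t ^ g2 ≤ 1) ∧
      ((t ≤ p ∨ q ≤ t) → 1 ≤ m * t ^ (-g1) + n * t ^ g2) := by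
  rcases hpq.eq_or_lt with rfl | hlt
  · refine ⟨p ^ g1 * (g2 / (g1 + g2)), p ^ (-g2) * (g1 / (g1 + g2)), fun t ht => ⟨?_, ?_⟩⟩
    · intro a b
      obtain rfl : p = t := le_antisymm a b
      have e1 : p ^ g1 * p ^ (-g1) = 1 := by rw [← rpow_add hp]; simp
      have e2 : p ^ (-g2) * p ^ g2 = 1 := by rw [← rpow_add hp]; simp
      apply le_of_eq
      calc _ = (p ^ g1 * p ^ (-g1)) * (g2 / (g1 + g2)) + (p ^ (-g2) * p ^ g2) * (g1 / (g1 + g2)) := by ring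
        _ = 1 := by rw [e1, e2]; field_simp; ring
    · intro _
      have hS : 0 < g1 + g2 := by linarith
      have hpt : 0 < t / p := by positivity
      have := Real.geom_mean_le_arith_mean2_weighted (w₁ := g2 / (g1 + g2)) (w₂ := g1 / (g1 + g2))
        (p₁ := (t / p) ^ (-g1)) (p₂ := (t / p) ^ g2) (by positivity) (by positivity)
        (by positivity) (by positivity) (by field_simp; ring)
      rw [← rpow_mul hpt.le, ← rpow_mul hpt.le, ← rpow_add hpt] at this
      have e : -g1 * (g2 / (g1 + g2)) + g2 * (g1 / (g1 + g2)) = 0 := by ring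
      rw [e, rpow_zero, div_rpow ht.le hp.le, div_rpow ht.le hp.le, rpow_neg hp.le] at this
      rw [rpow_neg hp.le]
      convert this using 1
      have : p ^ g1 ≠ 0 := by positivity
      field_simp
  · have hq : 0 < q := hp.trans hlt
    have k1 : q ^ (-g1) < p ^ (-g1) := rpow_lt_rpow_of_neg hp hlt (by linarith)
    have k2 : p ^ g2 < q ^ g2 := rpow_lt_rpow hp.le hlt h2
    have pp1 : 0 < q ^ (-g1) := by positivity
    have pp2 : 0 < p ^ g2 := by positivity
    have hD : 0 < p ^ (-g1) * q ^ g2 - q ^ (-g1) * p ^ g2 := by nlinarith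
    set D := p ^ (-g1) * q ^ g2 - q ^ (-g1) * p ^ g2 with hDd
    obtain ⟨m, hm⟩ : ∃ m, m = (q ^ g2 - p ^ g2) / D := ⟨_, rfl⟩
    obtain ⟨n, hn⟩ : ∃ n, n = (p ^ (-g1) - q ^ (-g1)) / D := ⟨_, rfl⟩
    have hm0 : 0 ≤ m := by rw [hm]; exact div_nonneg (by linarith) hD.le
    have hn0 : 0 ≤ n := by rw [hn]; exact div_nonneg (by linarith) hD.le
    have Fp : m * p ^ (-g1) + n * p ^ g2 = 1 := by
      rw [hm, hn]; field_simp; rw [hDd]; ring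
    have Fq : m * q ^ (-g1) + n * q ^ g2 = 1 := by
      rw [hm, hn]; field_simp; rw [hDd]; ring
    have hexp : ∀ c : ℝ, ConvexOn ℝ univ (fun u : ℝ => exp (c * u)) := by
      intro c
      have := convexOn_exp.comp_linearMap (LinearMap.lsmul ℝ ℝ c)
      simpa [Function.comp_def] using this
    have hF : ConvexOn ℝ univ (fun u : ℝ => m * exp (-g1 * u) + n * exp (g2 * u)) := by
      have := ((hexp (-g1)).smul hm0).add ((hexp g2).smul hn0)
      simpa [Pi.add_def, smul_eq_mul] using this
    set F := (fun u : ℝ => m * exp (-g1 * u) + n * exp (g2 * u)) with hFd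
    have key : ∀ t : ℝ, 0 < t → m * t ^ (-g1) + n * t ^ g2 = F (log t) := by
      intro t ht
      rw [hFd, rpow_def_of_pos ht, rpow_def_of_pos ht]
      simp only [mul_comm]
    rw [key p hp] at Fp
    rw [key q hq] at Fq
    refine ⟨m, n, fun t ht => ?_⟩
    rw [key t ht]
    refine ⟨fun a b => ?_, ?_⟩
    · have := hF.le_max_of_mem_Icc (mem_univ (log p)) (mem_univ (log q)) (z := log t)
        ⟨log_le_log hp a, log_le_log ht b⟩
      rwa [Fp, Fq, max_self] at this
    · have hl := log_lt_log hp hlt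
      rintro (a | a)
      · rcases a.eq_or_lt with rfl | a
        · exact Fp.ge
        have hl2 := log_lt_log ht a
        have := hF.slope_mono_adjacent (mem_univ _) (mem_univ _) hl2 hl
        rw [Fp, Fq, sub_self, zero_div, div_le_iff₀ (by linarith)] at this
        linarith
      · rcases a.eq_or_lt with rfl | a
        · exact Fq.ge
        have hl2 := log_lt_log hq a
        have := hF.slope_mono_adjacent (mem_univ _) (mem_univ _) hl hl2
        rw [Fp, Fq, sub_self, zero_div, le_div_iff₀ (by linarith)] at this
        linarith

lemma vg_pm (a b l r G : ℝ) (ha : 0 < a) (hb : 0 < b) (hl : l ∈ Ioo (0:ℝ) 1) (hr : r < 0)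
    (h : a ^ l * b ^ (1 - l) ≤ G) : (l * a ^ r + (1 - l) * b ^ r) ^ (1 / r) ≤ G := by
  refine le_trans ?_ h
  obtain ⟨h0, h1⟩ := hl
  have hg : 0 < a ^ l * b ^ (1 - l) := by positivity
  have := Real.geom_mean_le_arith_mean2_weighted (w₁ := l) (w₂ := 1 - l)
        (p₁ := a ^ r) (p₂ := b ^ r) h0.le (by linarith)
        (by positivity) (by positivity) (by ring)
  have e : (a ^ r) ^ l * (b ^ r) ^ (1 - l) = (a ^ l * b ^ (1 - l)) ^ r := by
    rw [mul_rpow (by positivity) (by positivity), ← rpow_mul ha.le, ← rpow_mul hb.le,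
      ← rpow_mul ha.le, ← rpow_mul hb.le, mul_comm r, mul_comm r]
  rw [e] at this
  have h2 := rpow_le_rpow_of_nonpos (by positivity) this (z := 1 / r)
    (one_div_nonpos.2 hr.le)
  rwa [← rpow_mul hg.le, mul_one_div_cancel hr.ne, rpow_one] at h2

/-- hypotheses on the weight -/
structure VGWeight (w : ℝ → ℝ) : Prop where
  cont : ContinuousOn w (Ioi 0)
  pos : ∀ t, 0 < t → 0 < w t
  lc : ConcaveOn ℝ univ (fun u => log (w (exp u)))
  int : ∀ β : ℝ, -1 < β → IntegrableOn (fun t => t ^ β * w t) (Ioi 0)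
  decay : ∀ a : ℝ, Filter.Tendsto (fun t => t ^ a * w t) Filter.atTop (nhds 0)

lemma vg_pos {w : ℝ → ℝ} (hw : VGWeight w) {β s : ℝ} (hβ : -1 < β) (hs : 0 ≤ s) :
    0 < ∫ t in Ioi s, t ^ β * w t := by
  rw [setIntegral_pos_iff_support_of_nonneg_ae]
  · have : Ioi s ⊆ (Function.support fun t => t ^ β * w t) ∩ Ioi s := by
      intro t ht
      have ht0 : 0 < t := lt_of_le_of_lt hs ht
      exact ⟨(mul_pos (rpow_pos_of_pos ht0 _) (hw.pos t ht0)).ne', ht⟩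
    refine lt_of_lt_of_le ?_ (measure_mono this)
    simp
  · filter_upwards [ae_restrict_mem measurableSet_Ioi] with t ht
    have ht0 : 0 < t := lt_of_le_of_lt hs ht
    exact (mul_pos (rpow_pos_of_pos ht0 _) (hw.pos t ht0)).le
  · exact (hw.int β hβ).mono_set (Ioi_subset_Ioi hs)

/-- crossing comparison -/
lemma vg_cross {w : ℝ → ℝ} (hw : VGWeight w) {s a c b1 b2 l : ℝ} (hs : 0 < s) (hc : 0 < c)
    (hb1 : -1 < b1) (hlt : b1 < b2) (hl : l ∈ Ioo (0:ℝ) 1) (ha : b2 + 1 < a)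
    (h1 : ∫ t in Ioi s, t ^ b1 * w t = ∫ t in Ioi s, t ^ b1 * (c * t ^ (-a)))
    (h2 : ∫ t in Ioi s, t ^ b2 * w t = ∫ t in Ioi s, t ^ b2 * (c * t ^ (-a))) :
    ∫ t in Ioi s, t ^ (l * b1 + (1 - l) * b2) * (c * t ^ (-a)) ≤
    ∫ t in Ioi s, t ^ (l * b1 + (1 - l) * b2) * w t := by
  obtain ⟨l0, l1⟩ := hl
  set b := l * b1 + (1 - l) * b2 with hb
  have g1 : 0 < b - b1 := by rw [hb]; nlinarith
  have g2 : 0 < b2 - b := by rw [hb]; nlinarith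
  have intw : ∀ β : ℝ, -1 < β → IntegrableOn (fun t => t ^ β * w t) (Ioi s) := fun β h =>
    (hw.int β h).mono_set (Ioi_subset_Ioi hs.le)
  have intc : ∀ β : ℝ, β ≤ b2 → IntegrableOn (fun t => t ^ β * (c * t ^ (-a))) (Ioi s) := by
    intro β h
    have := (integrableOn_Ioi_rpow_of_lt (a := β - a) (by linarith) hs).const_mul c
    refine IntegrableOn.congr_fun this (fun t ht => ?_) measurableSet_Ioi
    have ht0 : 0 < t := lt_trans hs ht
    simp only [sub_eq_add_neg, rpow_add ht0]; ring
  -- the superlevel set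
  set S : Set ℝ := {t | s < t ∧ c * t ^ (-a) ≤ w t} with hS
  have hiff : ∀ t, 0 < t → (c * t ^ (-a) ≤ w t ↔ log c ≤ log (w (exp (log t))) + a * log t) := by
    intro t ht
    rw [exp_log ht, ← Real.log_le_log_iff (by positivity) (hw.pos t ht),
      log_mul hc.ne' (by positivity), log_rpow ht]
    constructor <;> intro <;> linarith
  have hconc : ConcaveOn ℝ univ (fun u => log (w (exp u)) + a * u) := by
    refine hw.lc.add ?_
    exact (LinearMap.lsmul ℝ ℝ a).concaveOn convex_univ
  have hconn : ∀ t1 ∈ S, ∀ t2 ∈ S, ∀ t, t1 ≤ t → t ≤ t2 → t ∈ S := by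
    intro t1 ht1 t2 ht2 t a1 a2
    have p1 : 0 < t1 := hs.trans ht1.1
    have p : 0 < t := p1.trans_le a1
    have p2 : 0 < t2 := hs.trans ht2.1
    refine ⟨ht1.1.trans_le a1, (hiff t p).2 ?_⟩
    have := hconc.min_le_of_mem_Icc (mem_univ (log t1)) (mem_univ (log t2)) (z := log t)
      ⟨log_le_log p1 a1, log_le_log p a2⟩
    exact le_trans (le_min ((hiff t1 p1).1 ht1.2) ((hiff t2 p2).1 ht2.2)) this
  have hbdd : BddAbove S := by
    have := (hw.decay a).eventually (gt_mem_nhds hc)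
    obtain ⟨N, hN⟩ := Filter.eventually_atTop.1 this
    refine ⟨N, fun t ht => ?_⟩
    by_contra hcon
    push Not at hcon
    have h3 := hN t hcon.le
    have ht0 : 0 < t := hs.trans ht.1
    have h4 := mul_le_mul_of_nonneg_left ht.2 (rpow_pos_of_pos ht0 a).le
    have e : t ^ a * (c * t ^ (-a)) = c := by
      rw [mul_left_comm, ← rpow_add ht0]; simp
    linarith
  have hbddb : BddBelow S := ⟨s, fun t ht => ht.1.le⟩
  -- endpoints
  obtain ⟨p, q, hp, hpq, hin, hout⟩ : ∃ p q : ℝ, 0 < p ∧ p ≤ q ∧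
      (∀ t, p < t → t < q → t ∈ S) ∧ (∀ t, t < p ∨ q < t → t ∉ S) := by
    rcases S.eq_empty_or_nonempty with hE | hne
    · exact ⟨1, 1, one_pos, le_rfl, fun t a b => by linarith, fun t _ => by rw [hE]; simp⟩
    · refine ⟨sInf S, sSup S, hs.trans_le (le_csInf hne fun t ht => ht.1.le),
        ?_, ?_, ?_⟩
      · exact csInf_le_csSup hne hbddb hbdd
      · intro t a1 a2
        obtain ⟨t1, ht1, h1⟩ := exists_lt_of_csInf_lt hne a1
        obtain ⟨t2, ht2, h2⟩ := exists_lt_of_lt_csSup hne a2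
        exact hconn t1 ht1 t2 ht2 t h1.le h2.le
      · rintro t (h | h) ht
        · exact absurd (csInf_le hbddb ht) (not_le.2 h)
        · exact absurd (le_csSup hbdd ht) (not_le.2 h)
  obtain ⟨m, n, hmn⟩ := vg_interp p q (b - b1) (b2 - b) hp hpq g1 g2
  have hpt : ∀ t ∈ Ioi s, 0 ≤ (t ^ b * w t - t ^ b * (c * t ^ (-a)))
      - m * (t ^ b1 * w t - t ^ b1 * (c * t ^ (-a))) - n * (t ^ b2 * w t - t ^ b2 * (c * t ^ (-a))) := by
    intro t ht
    have ht0 : 0 < t := hs.trans ht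
    have e1 : t ^ b1 = t ^ b * t ^ (-(b - b1)) := by rw [← rpow_add ht0]; ring_nf
    have e2 : t ^ b2 = t ^ b * t ^ (b2 - b) := by rw [← rpow_add ht0]; ring_nf
    have e : (t ^ b * w t - t ^ b * (c * t ^ (-a)))
      - m * (t ^ b1 * w t - t ^ b1 * (c * t ^ (-a))) - n * (t ^ b2 * w t - t ^ b2 * (c * t ^ (-a)))
      = t ^ b * ((w t - c * t ^ (-a)) * (1 - (m * t ^ (-(b - b1)) + n * t ^ (b2 - b)))) := by
      rw [e1, e2]; ring
    rw [e]
    refine mul_nonneg (rpow_pos_of_pos ht0 _).le ?_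
    obtain ⟨q1, q2⟩ := hmn t ht0
    by_cases hA : p < t ∧ t < q
    · exact mul_nonneg (sub_nonneg.2 (hin t hA.1 hA.2).2) (sub_nonneg.2 (q1 hA.1.le hA.2.le))
    · have hA' : t ≤ p ∨ q ≤ t := by
        by_contra hcon; push Not at hcon; exact hA hcon
      have q3 := q2 hA'
      by_cases hB : p ≤ t ∧ t ≤ q
      · have := q1 hB.1 hB.2
        rw [le_antisymm this q3]; simp
      · have hB' : t < p ∨ q < t := by
          by_contra hcon; push Not at hcon; exact hB hcon
        have hn := hout t hB'
        have : w t ≤ c * t ^ (-a) := by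
          by_contra hcon; push Not at hcon; exact hn ⟨ht, hcon.le⟩
        exact mul_nonneg_of_nonpos_of_nonpos (by linarith) (by linarith)
  have hfin := setIntegral_nonneg (μ := volume) measurableSet_Ioi hpt
  have i0 := (intw b (by linarith)).sub (intc b (by linarith))
  have i1 := ((intw b1 hb1).sub (intc b1 hlt.le)).const_mul m
  have i2 := ((intw b2 (by linarith)).sub (intc b2 le_rfl)).const_mul n
  have E1 := integral_sub (i0.sub i1) i2
  have E2 := integral_sub i0 i1
  have E3 := integral_sub (intw b (by linarith)) (intc b (by linarith))
  have E4 := integral_sub (intw b1 hb1) (intc b1 hlt.le)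
  have E5 := integral_sub (intw b2 (by linarith)) (intc b2 le_rfl)
  simp only [Pi.sub_apply] at E1 E2 E3 E4 E5
  rw [E1, E2, integral_const_mul, integral_const_mul, E3, E4, E5, h1, h2] at hfin
  linarith

lemma vg_hazard {w : ℝ → ℝ} (hw : VGWeight w) {s b1 b2 l : ℝ} (hs : 0 < s)
    (hb1 : -1 < b1) (hlt : b1 < b2) (hl : l ∈ Ioo (0:ℝ) 1) :
    s ^ (l * b1 + (1 - l) * b2) * w s / (∫ t in Ioi s, t ^ (l * b1 + (1 - l) * b2) * w t) ≤
    l * (s ^ b1 * w s / ∫ t in Ioi s, t ^ b1 * w t) +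
    (1 - l) * (s ^ b2 * w s / ∫ t in Ioi s, t ^ b2 * w t) := by
  have hl' := hl
  obtain ⟨l0, l1⟩ := hl
  have P1 := vg_pos hw (s := s) hb1 hs.le
  have P2 := vg_pos hw (s := s) (hb1.trans hlt) hs.le
  have P := vg_pos hw (s := s) (β := l * b1 + (1 - l) * b2) (by nlinarith) hs.le
  have intw : ∀ β : ℝ, -1 < β → IntegrableOn (fun t => t ^ β * w t) (Ioi s) := fun β h =>
    (hw.int β h).mono_set (Ioi_subset_Ioi hs.le)
  have hstrict : 0 < ∫ t in Ioi s, (t ^ b2 * w t - s ^ (b2 - b1) * (t ^ b1 * w t)) := by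
    have hpos : ∀ t ∈ Ioi s, 0 < t ^ b2 * w t - s ^ (b2 - b1) * (t ^ b1 * w t) := by
      intro t ht
      have ht0 : 0 < t := hs.trans ht
      have e2 : t ^ b2 = t ^ b1 * t ^ (b2 - b1) := by rw [← rpow_add ht0]; ring_nf
      have := rpow_lt_rpow hs.le ht (z := b2 - b1) (by linarith)
      rw [e2]
      have := mul_pos (mul_pos (rpow_pos_of_pos ht0 b1) (hw.pos t ht0)) (sub_pos.2 this)
      nlinarith
    rw [setIntegral_pos_iff_support_of_nonneg_ae]
    · refine lt_of_lt_of_le ?_ (measure_mono (s := Ioi s) fun t ht => ⟨(hpos t ht).ne', ht⟩)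
      simp
    · filter_upwards [ae_restrict_mem measurableSet_Ioi] with t ht
      exact (hpos t ht).le
    · exact (intw b2 (by linarith)).sub ((intw b1 hb1).const_mul _)
  rw [integral_sub (intw b2 (by linarith)) ((intw b1 hb1).const_mul _), integral_const_mul] at hstrict
  have hcr := fun a c hc ha h1 h2 =>
    vg_cross hw (s := s) (a := a) (c := c) (l := l) hs hc hb1 hlt hl' ha h1 h2
  have hcI : ∀ a c β : ℝ, β + 1 < a → ∫ t in Ioi s, t ^ β * (c * t ^ (-a)) =
      c * (s ^ (β + 1) * s ^ (-a) / (a - 1 - β)) := by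
    intro a c β h
    have : ∫ t in Ioi s, t ^ β * (c * t ^ (-a)) = ∫ t in Ioi s, c * t ^ (β - a) := by
      refine setIntegral_congr_fun measurableSet_Ioi fun t ht => ?_
      have ht0 : 0 < t := hs.trans ht
      simp only [sub_eq_add_neg, rpow_add ht0]; ring
    rw [this, integral_const_mul, integral_Ioi_rpow_of_lt (by linarith) hs, ← rpow_add hs]
    congr 1
    rw [show β + 1 + -a = β - a + 1 by ring, neg_div, ← div_neg]
    congr 1; ring
  set A1 := ∫ t in Ioi s, t ^ b1 * w t
  set A2 := ∫ t in Ioi s, t ^ b2 * w t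
  set b := l * b1 + (1 - l) * b2 with hb
  set A := ∫ t in Ioi s, t ^ b * w t
  obtain ⟨ρ1, hρ1⟩ : ∃ ρ, ρ = s ^ (b1 + 1) / A1 := ⟨_, rfl⟩
  obtain ⟨ρ2, hρ2⟩ : ∃ ρ, ρ = s ^ (b2 + 1) / A2 := ⟨_, rfl⟩
  have r1 : 0 < ρ1 := by rw [hρ1]; positivity
  have r2 : 0 < ρ2 := by rw [hρ2]; positivity
  have hρ : ρ2 < ρ1 := by
    rw [hρ1, hρ2, div_lt_div_iff₀ P2 P1]
    have e : s ^ (b2 + 1) = s ^ (b1 + 1) * s ^ (b2 - b1) := by rw [← rpow_add hs]; ring_nf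
    rw [e]
    have := mul_pos (rpow_pos_of_pos hs (b1 + 1)) hstrict
    nlinarith
  obtain ⟨k, hk⟩ : ∃ k, k = (ρ1 - ρ2) / (b2 - b1) := ⟨_, rfl⟩
  have hk0 : 0 < k := by rw [hk]; exact div_pos (by linarith) (by linarith)
  have hkm : k * (b2 - b1) = ρ1 - ρ2 := by
    rw [hk]; exact div_mul_cancel₀ _ (by linarith)
  obtain ⟨a, ha⟩ : ∃ a, a = 1 + b1 + ρ1 / k := ⟨_, rfl⟩
  have ha1 : k * (a - 1 - b1) = ρ1 := by rw [ha]; field_simp; ring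
  have ha2 : k * (a - 1 - b2) = ρ2 := by linarith
  have ha3 : 0 < a - 1 - b2 := by
    by_contra hcon; push Not at hcon; nlinarith
  have hsa : 0 < s ^ (-a) := by positivity
  have hC : ∀ β, β + 1 < a → ∫ t in Ioi s, t ^ β * ((1 / (k * s ^ (-a))) * t ^ (-a)) =
      s ^ (β + 1) / (k * (a - 1 - β)) := by
    intro β h
    rw [hcI _ _ _ h]
    have : a - 1 - β ≠ 0 := by linarith
    field_simp
  have := hcr a (1 / (k * s ^ (-a))) (by positivity) (by linarith)
    (by rw [hC _ (by linarith), ha1, hρ1]; field_simp)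
    (by rw [hC _ (by linarith), ha2, hρ2]; field_simp)
  have hba : b + 1 < a := by rw [hb]; nlinarith
  rw [hC _ hba] at this
  have e3 : k * (a - 1 - b) = l * ρ1 + (1 - l) * ρ2 := by
    rw [← ha1, ← ha2, hb]; ring
  rw [e3, div_le_iff₀ (by nlinarith)] at this
  have hws := hw.pos s hs
  rw [rpow_add hs, rpow_one] at this hρ1 hρ2
  rw [div_le_iff₀ P]
  have e4 : l * (s ^ b1 * w s / A1) + (1 - l) * (s ^ b2 * w s / A2) =
      (l * ρ1 + (1 - l) * ρ2) * (w s / s) := by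
    rw [hρ1, hρ2]; field_simp
  rw [e4]
  have := mul_le_mul_of_nonneg_right this (div_pos hws hs).le
  calc s ^ b * w s = s ^ b * s * (w s / s) := by field_simp
    _ ≤ _ := this
    _ = _ := by ring

lemma vg_mono {w : ℝ → ℝ} (hw : VGWeight w) {s b1 b2 l : ℝ} (hs : 0 < s)
    (hb1 : -1 < b1) (hlt : b1 < b2) (hl : l ∈ Ioo (0:ℝ) 1) :
    log (∫ t in Ioi 0, t ^ (l * b1 + (1 - l) * b2) * w t)
      - l * log (∫ t in Ioi 0, t ^ b1 * w t) - (1 - l) * log (∫ t in Ioi 0, t ^ b2 * w t) ≤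
    log (∫ t in Ioi s, t ^ (l * b1 + (1 - l) * b2) * w t)
      - l * log (∫ t in Ioi s, t ^ b1 * w t) - (1 - l) * log (∫ t in Ioi s, t ^ b2 * w t) := by
  have hb2 : -1 < b2 := hb1.trans hlt
  have hb : -1 < l * b1 + (1 - l) * b2 := by nlinarith [hl.1, hl.2]
  have hIoi : ∀ β : ℝ, -1 < β → ∀ y, 0 ≤ y → ∫ t in Ioi y, t ^ β * w t =
      (∫ t in Ioi 0, t ^ β * w t) - ∫ t in (0:ℝ)..y, t ^ β * w t := by
    intro β hβ y hy
    have := intervalIntegral.integral_Ioi_sub_Ioi (hw.int β hβ) hy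
    linarith
  have hcont : ∀ β : ℝ, -1 < β → ContinuousOn (fun y => ∫ t in Ioi y, t ^ β * w t) (Icc 0 s) := by
    intro β hβ
    have h1 : ContinuousOn (fun y => ∫ t in (0:ℝ)..y, t ^ β * w t) (Icc 0 s) := by
      rw [← uIcc_of_le hs.le]
      apply intervalIntegral.continuousOn_primitive_interval
      rw [uIcc_of_le hs.le, integrableOn_Icc_iff_integrableOn_Ioc]
      exact (hw.int β hβ).mono_set Ioc_subset_Ioi_self
    exact (continuousOn_const.sub h1).congr fun y hy => hIoi β hβ y hy.1
  have hder : ∀ β : ℝ, -1 < β → ∀ y, 0 < y →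
      HasDerivAt (fun y => ∫ t in Ioi y, t ^ β * w t) (-(y ^ β * w y)) y := by
    intro β hβ y hy
    have hc : ContinuousOn (fun t => t ^ β * w t) (Ioi 0) :=
      (continuousOn_id.rpow_const fun t ht => Or.inl (ne_of_gt ht)).mul hw.cont
    have h1 : HasDerivAt (fun y => ∫ t in (0:ℝ)..y, t ^ β * w t) (y ^ β * w y) y := by
      apply intervalIntegral.integral_hasDerivAt_right
      · rw [intervalIntegrable_iff_integrableOn_Ioc_of_le hy.le]
        exact (hw.int β hβ).mono_set Ioc_subset_Ioi_self
      · exact hc.stronglyMeasurableAtFilter isOpen_Ioi y hy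
      · exact hc.continuousAt (Ioi_mem_nhds hy)
    have h2 := h1.const_sub (∫ t in Ioi 0, t ^ β * w t)
    refine h2.congr_of_eventuallyEq ?_
    filter_upwards [Ioi_mem_nhds hy] with z hz
    exact hIoi β hβ z (le_of_lt hz)
  have hlog : ∀ β : ℝ, -1 < β → ContinuousOn (fun y => log (∫ t in Ioi y, t ^ β * w t)) (Icc 0 s) :=
    fun β hβ => (hcont β hβ).log fun y hy => (vg_pos hw hβ hy.1).ne'
  have hdlog : ∀ β : ℝ, -1 < β → ∀ y, 0 < y →
      HasDerivAt (fun y => log (∫ t in Ioi y, t ^ β * w t))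
        (-(y ^ β * w y) / ∫ t in Ioi y, t ^ β * w t) y :=
    fun β hβ y hy => (hder β hβ y hy).log (vg_pos hw hβ hy.le).ne'
  have hD : ∀ y, 0 < y → HasDerivAt (fun y => log (∫ t in Ioi y, t ^ (l * b1 + (1 - l) * b2) * w t)
      - l * log (∫ t in Ioi y, t ^ b1 * w t) - (1 - l) * log (∫ t in Ioi y, t ^ b2 * w t)) _ y :=
    fun y hy => (((hdlog _ hb y hy).sub ((hdlog b1 hb1 y hy).const_mul l)).sub
      ((hdlog b2 hb2 y hy).const_mul (1 - l)))
  have hmono : MonotoneOn (fun y => log (∫ t in Ioi y, t ^ (l * b1 + (1 - l) * b2) * w t)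
      - l * log (∫ t in Ioi y, t ^ b1 * w t) - (1 - l) * log (∫ t in Ioi y, t ^ b2 * w t)) (Icc 0 s) := by
    apply monotoneOn_of_deriv_nonneg (convex_Icc 0 s)
    · exact ((hlog _ hb).sub (continuousOn_const.mul (hlog _ hb1))).sub
        (continuousOn_const.mul (hlog _ hb2))
    · rw [interior_Icc]
      exact fun y hy => (hD y hy.1).differentiableAt.differentiableWithinAt
    · rw [interior_Icc]
      intro y hy
      rw [(hD y hy.1).deriv]
      have := vg_hazard hw hy.1 hb1 hlt hl
      simp only [neg_div]
      linarith
  exact hmono ⟨le_rfl, hs.le⟩ ⟨hs.le, le_rfl⟩ hs.le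

lemma vg_geom {w : ℝ → ℝ} (hw : VGWeight w) {s b1 b2 l : ℝ} (hs : 0 < s)
    (hb1 : -1 < b1) (hlt : b1 < b2) (hl : l ∈ Ioo (0:ℝ) 1) :
    ((∫ t in Ioi s, t ^ b1 * w t) / (∫ t in Ioi 0, t ^ b1 * w t)) ^ l *
    ((∫ t in Ioi s, t ^ b2 * w t) / (∫ t in Ioi 0, t ^ b2 * w t)) ^ (1 - l) ≤
    (∫ t in Ioi s, t ^ (l * b1 + (1 - l) * b2) * w t) /
      (∫ t in Ioi 0, t ^ (l * b1 + (1 - l) * b2) * w t) := by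
  have h := vg_mono hw hs hb1 hlt hl
  have hb2 : -1 < b2 := hb1.trans hlt
  have hb : -1 < l * b1 + (1 - l) * b2 := by nlinarith [hl.1, hl.2]
  have p1 := vg_pos hw hb1 hs.le
  have p2 := vg_pos hw hb2 hs.le
  have p3 := vg_pos hw hb hs.le
  have q1 := vg_pos hw hb1 le_rfl
  have q2 := vg_pos hw hb2 le_rfl
  have q3 := vg_pos hw hb le_rfl
  rw [← Real.log_le_log_iff (by positivity) (by positivity), log_mul (by positivity) (by positivity),
    log_rpow (by positivity), log_rpow (by positivity), log_div p1.ne' q1.ne',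
    log_div p2.ne' q2.ne', log_div p3.ne' q3.ne']
  linarith

lemma vg_weight (x α zstar : ℝ)
    (hx0 : 0 < x) (hx1 : x < 1) (hz : 0 < zstar)
    (hmin : ∀ y ∈ Set.Ioi (0 : ℝ), Real.Gamma zstar ≤ Real.Gamma y) (hα : zstar < α) :
    VGWeight (fun t => x ^ (t + α) / Real.Gamma (t + α + 1)) := by
  have hlx : log x < 0 := log_neg hx0 hx1
  have hα0 : 0 < α := hz.trans hα
  have hGz : 0 < Real.Gamma zstar := Real.Gamma_pos_of_pos hz
  have hcont : ContinuousOn (fun t => x ^ (t + α) / Real.Gamma (t + α + 1)) (Ioi 0) := by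
    intro t ht
    have ht' : (0:ℝ) < t := ht
    apply ContinuousAt.continuousWithinAt
    refine ContinuousAt.div ?_ ?_ (Real.Gamma_pos_of_pos (by linarith)).ne'
    · exact (continuousAt_const.rpow (by fun_prop) (Or.inl hx0.ne'))
    · have := (Real.differentiableAt_Gamma (s := t + α + 1) (fun m => by
        have : (0:ℝ) ≤ m := Nat.cast_nonneg m
        linarith)).continuousAt
      exact ContinuousAt.comp (f := fun t : ℝ => t + α + 1) this (by fun_prop)
  have hpos : ∀ t, 0 < t → 0 < x ^ (t + α) / Real.Gamma (t + α + 1) := fun t ht =>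
    div_pos (by positivity) (Real.Gamma_pos_of_pos (by linarith))
  have hbound : ∀ t, 0 < t → x ^ (t + α) / Real.Gamma (t + α + 1) ≤
      (x ^ α / Real.Gamma zstar) * exp (-(-log x) * t) := by
    intro t ht
    have h1 := hmin (t + α + 1) (show 0 < t + α + 1 by linarith)
    have e : exp (-(-log x) * t) = x ^ t := by rw [rpow_def_of_pos hx0, neg_neg]
    rw [e, div_mul_eq_mul_div, ← rpow_add hx0, add_comm α t]
    gcongr
  refine ⟨hcont, hpos, ?_, ?_, ?_⟩
  · have hconvex := Real.convexOn_log_Gamma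
    have hmon : MonotoneOn (log ∘ Real.Gamma) (Ioi zstar) := by
      intro a ha b hb hab
      have ha' : zstar < a := ha
      have := hconvex.le_max_of_mem_Icc (x := zstar) (y := b) (z := a) hz
        (show 0 < b by linarith) ⟨ha'.le, hab⟩
      rwa [max_eq_right] at this
      exact log_le_log hGz (hmin b (show 0 < b by linarith))
    have himg : (fun u : ℝ => exp u + (α + 1)) '' univ ⊆ Ioi zstar := by
      rintro _ ⟨u, -, rfl⟩
      have := exp_pos u
      show zstar < exp u + (α + 1)
      linarith
    have hc2 : ConvexOn ℝ univ (fun u : ℝ => exp u + (α + 1)) := convexOn_exp.add_const (α + 1)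
    have hset : (fun u : ℝ => exp u + (α + 1)) '' univ = Ioi (α + 1) := by
      ext y
      constructor
      · rintro ⟨u, -, rfl⟩
        have := exp_pos u
        show α + 1 < exp u + (α + 1)
        linarith
      · intro hy
        have hy' : α + 1 < y := hy
        exact ⟨log (y - (α + 1)), mem_univ _, by
          simp only; rw [exp_log (by linarith)]; ring⟩
    have hcomp := ConvexOn.comp (g := log ∘ Real.Gamma) (f := fun u : ℝ => exp u + (α + 1))
      (s := univ) (by
        rw [hset]
        exact hconvex.subset (fun y hy => show (0:ℝ) < y by
          have : α + 1 < y := hy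
          linarith) (convex_Ioi _)) hc2 (hmon.mono himg)
    have hc3 : ConcaveOn ℝ univ (fun u : ℝ => log x * exp u + log x * α) := by
      have := (convexOn_exp.smul (c := -log x) (by linarith)).neg
      have := this.add_const (log x * α)
      refine this.congr fun u _ => ?_
      simp
    refine (hc3.sub hcomp).congr fun u _ => ?_
    have := exp_pos u
    have hg : 0 < Real.Gamma (exp u + α + 1) := Real.Gamma_pos_of_pos (by linarith)
    simp only [Pi.sub_apply, Function.comp]
    rw [log_div (by positivity) hg.ne', log_rpow hx0, add_assoc]
    ring
  · intro β hβ
    have h0 := (integrableOn_rpow_mul_exp_neg_mul_rpow (p := 1) (s := β) (b := -log x) hβ one_pos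
      (by linarith)).const_mul (x ^ α / Real.Gamma zstar)
    refine Integrable.mono' h0 ?_ ?_
    · apply ContinuousOn.aestronglyMeasurable _ measurableSet_Ioi
      exact (continuousOn_id.rpow_const fun t ht => Or.inl (ne_of_gt ht)).mul hcont
    · filter_upwards [ae_restrict_mem measurableSet_Ioi] with t ht
      have ht' : (0:ℝ) < t := ht
      rw [norm_of_nonneg (mul_pos (rpow_pos_of_pos ht' _) (hpos t ht')).le, rpow_one]
      have := mul_le_mul_of_nonneg_left (hbound t ht') (rpow_pos_of_pos ht' β).le
      linarith
  · intro a
    have h0 := (tendsto_rpow_mul_exp_neg_mul_atTop_nhds_zero a (-log x) (by linarith)).const_mul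
      (x ^ α / Real.Gamma zstar)
    rw [mul_zero] at h0
    refine squeeze_zero' ?_ ?_ h0
    · filter_upwards [Filter.eventually_gt_atTop 0] with t ht
      exact (mul_pos (rpow_pos_of_pos ht _) (hpos t ht)).le
    · filter_upwards [Filter.eventually_gt_atTop 0] with t ht
      have := mul_le_mul_of_nonneg_left (hbound t ht) (rpow_pos_of_pos ht a).le
      linarith

lemma vg_G (x α s β : ℝ) (hβ : -1 < β) :
    volterraG β x α s = (∫ t in Ioi s, t ^ β * (x ^ (t + α) / Real.Gamma (t + α + 1))) /
      (∫ t in Ioi 0, t ^ β * (x ^ (t + α) / Real.Gamma (t + α + 1))) := by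
  have hg : Real.Gamma (β + 1) ≠ 0 := (Real.Gamma_pos_of_pos (by linarith)).ne'
  have h : ∀ y : ℝ, ∫ t in Ioi y, x ^ (t + α) * t ^ β / (Real.Gamma (t + α + 1) * Real.Gamma (β + 1))
      = (Real.Gamma (β + 1))⁻¹ * ∫ t in Ioi y, t ^ β * (x ^ (t + α) / Real.Gamma (t + α + 1)) := by
    intro y
    rw [← integral_const_mul]
    congr 1; ext t
    rw [div_eq_mul_inv, mul_inv]; ring
  rw [volterraG, volterraMuInc, volterraMu, h, h, mul_div_mul_left _ _ (inv_ne_zero hg)]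

/-- Power-mean lower bound for the normalized incomplete Volterra function `G_β`:
for `r ≤ 0`, `M_r(G_{β₁}, G_{β₂}; λ) ≤ G_{λβ₁+(1-λ)β₂}`. -/
theorem volterraG_powerMean_inequality (x α s zstar : ℝ)
    (hx0 : 0 < x) (hx1 : x < 1) (hs : 0 < s)
    (hzstar : zstar ∈ Set.Ioi (0 : ℝ))
    (hmin : ∀ y ∈ Set.Ioi (0 : ℝ), Real.Gamma zstar ≤ Real.Gamma y)
    (hα : zstar < α)
    (β₁ β₂ : ℝ) (hβ₁ : -1 < β₁) (hβ₂ : -1 < β₂) (hne : β₁ ≠ β₂)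
    (l : ℝ) (hl : l ∈ Set.Ioo (0 : ℝ) 1) (r : ℝ) (hr : r ≤ 0) :
    powerMean r (volterraG β₁ x α s) (volterraG β₂ x α s) l ≤
      volterraG (l * β₁ + (1 - l) * β₂) x α s := by
  have hw := vg_weight x α zstar hx0 hx1 hzstar hmin hα
  have hb : -1 < l * β₁ + (1 - l) * β₂ := by nlinarith [hl.1, hl.2]
  have hG1 : 0 < volterraG β₁ x α s := by
    rw [vg_G x α s β₁ hβ₁]; exact div_pos (vg_pos hw hβ₁ hs.le) (vg_pos hw hβ₁ le_rfl)
  have hG2 : 0 < volterraG β₂ x α s := by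
    rw [vg_G x α s β₂ hβ₂]; exact div_pos (vg_pos hw hβ₂ hs.le) (vg_pos hw hβ₂ le_rfl)
  have key : (volterraG β₁ x α s) ^ l * (volterraG β₂ x α s) ^ (1 - l) ≤
      volterraG (l * β₁ + (1 - l) * β₂) x α s := by
    rw [vg_G x α s _ hβ₁, vg_G x α s _ hβ₂, vg_G x α s _ hb]
    rcases lt_or_gt_of_ne hne with h | h
    · exact vg_geom hw hs hβ₁ h hl
    · have := vg_geom hw hs hβ₂ h (l := 1 - l) ⟨by linarith [hl.2], by linarith [hl.1]⟩
      rw [sub_sub_cancel, add_comm ((1 - l) * β₂), mul_comm (_ ^ (1 - l))] at this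
      exact this
  unfold powerMean
  split_ifs with h0
  · exact key
  · exact vg_pm _ _ l r _ hG1 hG2 hl (lt_of_le_of_ne hr h0) key
end

section
/- Let 0 < x < 1, s > 0, β > -1, and let α > z*, where z* ≈ 1.461632144 is the abscissa of the minimum of the gamma function on (0, ∞) (equivalently, Γ is strictly increasing on [z*, ∞)). Then the Turán-type inequality G*_{β+1}(x, α, s)² − G*_β(x, α, s) · G*_{β+2}(x, α, s) ≥ 0 holds. -/
open MeasureTheory Real Set

structure VLC (f q : ℝ → ℝ) : Prop where
  pos : ∀ t, 0 ≤ t → 0 < f t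
  der : ∀ t, 0 ≤ t → HasDerivAt f (-(q t * f t)) t
  mono : MonotoneOn q (Ici 0)
  nonneg : ∀ t, 0 ≤ t → 0 ≤ q t

noncomputable def vN (f : ℝ → ℝ) (e s : ℝ) : ℝ := ∫ t in (0:ℝ)..s, t ^ e * f t
noncomputable def vQ (f q : ℝ → ℝ) (e s : ℝ) : ℝ := ∫ t in (0:ℝ)..s, q t * (t ^ e * f t)

lemma v_cheb {s : ℝ} (hs : 0 < s) (v g h : ℝ → ℝ)
    (hv : ∀ t ∈ Icc 0 s, 0 ≤ v t) (hg : MonotoneOn g (Icc 0 s)) (hh : AntitoneOn h (Icc 0 s))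
    (i1 : IntervalIntegrable v volume 0 s)
    (ig : IntervalIntegrable (fun t => g t * v t) volume 0 s)
    (ih : IntervalIntegrable (fun t => h t * v t) volume 0 s)
    (igh : IntervalIntegrable (fun t => g t * (h t * v t)) volume 0 s) :
    (∫ t in (0:ℝ)..s, v t) * (∫ t in (0:ℝ)..s, g t * (h t * v t)) ≤
      (∫ t in (0:ℝ)..s, g t * v t) * (∫ t in (0:ℝ)..s, h t * v t) := by
  set A := ∫ t in (0:ℝ)..s, v t with hA
  set G := ∫ t in (0:ℝ)..s, g t * v t with hG
  set H := ∫ t in (0:ℝ)..s, h t * v t with hH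
  set K := ∫ t in (0:ℝ)..s, g t * (h t * v t) with hK
  have key : ∀ u ∈ Icc 0 s, 0 ≤ g u * H + h u * G - g u * h u * A - K := by
    intro u hu
    have e : g u * H + h u * G - g u * h u * A - K =
        ∫ t in (0:ℝ)..s, (g u * (h t * v t) + h u * (g t * v t) - g u * h u * v t
          - g t * (h t * v t)) := by
      rw [intervalIntegral.integral_sub, intervalIntegral.integral_sub,
        intervalIntegral.integral_add]
      · simp only [intervalIntegral.integral_const_mul]
        rfl
      · exact ih.const_mul _
      · exact ig.const_mul _
      · exact (ih.const_mul _).add (ig.const_mul _)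
      · exact i1.const_mul _
      · exact ((ih.const_mul _).add (ig.const_mul _)).sub (i1.const_mul _)
      · exact igh
    rw [e]
    apply intervalIntegral.integral_nonneg hs.le
    intro t ht
    have h1 : 0 ≤ (g u - g t) * (h t - h u) := by
      rcases le_total t u with h' | h'
      · exact mul_nonneg (sub_nonneg.2 (hg ht hu h')) (sub_nonneg.2 (hh ht hu h'))
      · exact mul_nonneg_of_nonpos_of_nonpos (sub_nonpos.2 (hg hu ht h'))
          (sub_nonpos.2 (hh hu ht h'))
    have := mul_nonneg h1 (hv t ht)
    nlinarith [this]
  have e2 : H * G + G * H - A * K - K * A =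
      ∫ u in (0:ℝ)..s, (H * (g u * v u) + G * (h u * v u) - A * (g u * (h u * v u)) - K * v u) := by
    rw [intervalIntegral.integral_sub, intervalIntegral.integral_sub,
        intervalIntegral.integral_add]
    · simp only [intervalIntegral.integral_const_mul]
      rfl
    · exact ig.const_mul _
    · exact ih.const_mul _
    · exact (ig.const_mul _).add (ih.const_mul _)
    · exact igh.const_mul _
    · exact ((ig.const_mul _).add (ih.const_mul _)).sub (igh.const_mul _)
    · exact i1.const_mul _
  have : 0 ≤ H * G + G * H - A * K - K * A := by
    rw [e2]
    apply intervalIntegral.integral_nonneg hs.le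
    intro u hu
    have := mul_nonneg (key u hu) (hv u hu)
    nlinarith [this]
  nlinarith [this]

namespace VLC
variable {f q : ℝ → ℝ}

lemma cont (H : VLC f q) (s : ℝ) (hs : 0 ≤ s) : ContinuousOn f (uIcc 0 s) := by
  intro t ht
  rw [uIcc_of_le hs] at ht
  exact (H.der t ht.1).continuousAt.continuousWithinAt

lemma intN (H : VLC f q) {e s : ℝ} (he : -1 < e) (hs : 0 ≤ s) :
    IntervalIntegrable (fun t => t ^ e * f t) volume 0 s :=
  (intervalIntegral.intervalIntegrable_rpow' he).mul_continuousOn (H.cont s hs)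

lemma intQ (H : VLC f q) {e s : ℝ} (he : 0 < e) (hs : 0 ≤ s) :
    IntervalIntegrable (fun t => q t * (t ^ e * f t)) volume 0 s := by
  have h1 : IntervalIntegrable q volume 0 s := by
    apply MonotoneOn.intervalIntegrable
    rw [uIcc_of_le hs]
    exact H.mono.mono (fun t ht => ht.1)
  exact h1.mul_continuousOn
    ((Real.continuous_rpow_const he.le).continuousOn.mul (H.cont s hs))

lemma ibp (H : VLC f q) {e s : ℝ} (he : -1 < e) (hs : 0 < s) :
    (e + 1) * vN f e s = s ^ (e + 1) * f s + vQ f q (e + 1) s := by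
  have h := intervalIntegral.integral_eq_sub_of_hasDerivAt_of_le
    (f := fun t => t ^ (e + 1) * f t)
    (f' := fun t => (e + 1) * (t ^ e * f t) - q t * (t ^ (e + 1) * f t)) hs.le
    (by
      have := H.cont s hs.le
      rw [uIcc_of_le hs.le] at this
      exact (Real.continuous_rpow_const (by linarith)).continuousOn.mul this)
    (by
      intro t ht
      have h1 := (Real.hasDerivAt_rpow_const (p := e + 1) (Or.inl ht.1.ne')).mul (H.der t ht.1.le)
      refine HasDerivAt.congr_deriv h1 ?_
      simp only [add_sub_cancel_right]
      ring)
    (((H.intN he hs.le).const_mul _).sub (H.intQ (by linarith) hs.le))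
  rw [intervalIntegral.integral_sub ((H.intN he hs.le).const_mul _)
    (H.intQ (by linarith) hs.le), intervalIntegral.integral_const_mul,
    Real.zero_rpow (by linarith : e + 1 ≠ 0)] at h
  unfold vN vQ
  linarith

lemma Npos (H : VLC f q) {e s : ℝ} (he : -1 < e) (hs : 0 < s) : 0 < vN f e s := by
  apply intervalIntegral.intervalIntegral_pos_of_pos_on (H.intN he hs.le) _ hs
  intro t ht
  exact mul_pos (Real.rpow_pos_of_pos ht.1 _) (H.pos t ht.1.le)

lemma Qnonneg (H : VLC f q) {e s : ℝ} (hs : 0 < s) : 0 ≤ vQ f q e s := by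
  apply intervalIntegral.integral_nonneg hs.le
  intro t ht
  exact mul_nonneg (H.nonneg t ht.1)
    (mul_nonneg (Real.rpow_nonneg ht.1 _) (H.pos t ht.1).le)

lemma pw {e t : ℝ} (he : -1 < e) (ht : 0 ≤ t) :
    t ^ (e + 1) = t * t ^ e ∧ t ^ (e + 2) = t ^ 2 * t ^ e ∧ t ^ (e + 3) = t ^ 3 * t ^ e := by
  have h1 := Real.rpow_add_one' ht (by linarith : e + 1 ≠ 0)
  have h2 := Real.rpow_add_one' ht (by linarith : (e + 1) + 1 ≠ 0)
  have h3 := Real.rpow_add_one' ht (by linarith : (e + 1 + 1) + 1 ≠ 0)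
  rw [show e + 2 = e + 1 + 1 by ring, show e + 3 = e + 1 + 1 + 1 by ring, h3, h2, h1]
  refine ⟨by ring, by ring, by ring⟩

lemma antih {s : ℝ} : AntitoneOn (fun t : ℝ => (s - t) ^ 2) (Icc 0 s) := by
  intro a ha b hb hab
  have := ha.2
  have := hb.2
  simp only
  nlinarith

/-- second moments of `(s-t)^2`. -/
lemma momN (H : VLC f q) {e s : ℝ} (he : -1 < e) (hs : 0 < s) :
    ∫ t in (0:ℝ)..s, (s - t) ^ 2 * (t ^ e * f t) =
      s ^ 2 * vN f e s - 2 * s * vN f (e + 1) s + vN f (e + 2) s := by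
  unfold vN
  have i0 := H.intN he hs.le
  have i1 := H.intN (by linarith : -1 < e + 1) hs.le
  have i2 := H.intN (by linarith : -1 < e + 2) hs.le
  rw [← intervalIntegral.integral_const_mul, ← intervalIntegral.integral_const_mul,
    ← intervalIntegral.integral_sub (i0.const_mul _) (i1.const_mul _),
    ← intervalIntegral.integral_add ((i0.const_mul _).sub (i1.const_mul _)) i2]
  apply intervalIntegral.integral_congr
  intro t ht
  rw [uIcc_of_le hs.le] at ht
  obtain ⟨h1, h2, -⟩ := pw he ht.1
  simp only [h1, h2]
  ring

lemma momQ (H : VLC f q) {e s : ℝ} (he : 0 < e) (hs : 0 < s) :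
    ∫ t in (0:ℝ)..s, q t * ((s - t) ^ 2 * (t ^ e * f t)) =
      s ^ 2 * vQ f q e s - 2 * s * vQ f q (e + 1) s + vQ f q (e + 2) s := by
  unfold vQ
  have i0 := H.intQ he hs.le
  have i1 := H.intQ (by linarith : 0 < e + 1) hs.le
  have i2 := H.intQ (by linarith : 0 < e + 2) hs.le
  rw [← intervalIntegral.integral_const_mul, ← intervalIntegral.integral_const_mul,
    ← intervalIntegral.integral_sub (i0.const_mul _) (i1.const_mul _),
    ← intervalIntegral.integral_add ((i0.const_mul _).sub (i1.const_mul _)) i2]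
  apply intervalIntegral.integral_congr
  intro t ht
  rw [uIcc_of_le hs.le] at ht
  obtain ⟨h1, h2, -⟩ := pw (by linarith : -1 < e) ht.1
  simp only [h1, h2]
  ring

lemma cheb1 (H : VLC f q) {e s : ℝ} (he : 0 < e) (hs : 0 < s) :
    vN f e s * (s ^ 2 * vQ f q e s - 2 * s * vQ f q (e + 1) s + vQ f q (e + 2) s) ≤
    vQ f q e s * (s ^ 2 * vN f e s - 2 * s * vN f (e + 1) s + vN f (e + 2) s) := by
  rw [← H.momQ he hs, ← H.momN (by linarith) hs]
  have hc : ContinuousOn (fun t : ℝ => (s - t) ^ 2) (uIcc 0 s) := by fun_prop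
  refine v_cheb hs (fun t => t ^ e * f t) q (fun t => (s - t) ^ 2) ?_ ?_ antih
    (H.intN (by linarith) hs.le) (H.intQ he hs.le)
    ((H.intN (by linarith) hs.le).continuousOn_mul hc) ?_
  · intro t ht
    exact mul_nonneg (Real.rpow_nonneg ht.1 _) (H.pos t ht.1).le
  · exact H.mono.mono (fun t ht => ht.1)
  · refine ((H.intQ he hs.le).continuousOn_mul hc).congr ?_
    intro t _
    simp only
    ring

lemma cheb2 (H : VLC f q) {e s : ℝ} (he : -1 < e) (hs : 0 < s) :
    vN f e s * (s ^ 2 * vN f (e + 1) s - 2 * s * vN f (e + 2) s + vN f (e + 3) s) ≤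
    vN f (e + 1) s * (s ^ 2 * vN f e s - 2 * s * vN f (e + 1) s + vN f (e + 2) s) := by
  have m := H.momN (by linarith : -1 < e + 1) hs
  rw [show e + 1 + 1 = e + 2 by ring, show e + 1 + 2 = e + 3 by ring] at m
  rw [← m, ← H.momN he hs]
  have hc : ContinuousOn (fun t : ℝ => (s - t) ^ 2) (uIcc 0 s) := by fun_prop
  have hc' : ContinuousOn (fun t : ℝ => t) (uIcc 0 s) := by fun_prop
  have i0 := H.intN he hs.le
  have := v_cheb hs (fun t => t ^ e * f t) (fun t => t) (fun t => (s - t) ^ 2)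
    (fun t ht => mul_nonneg (Real.rpow_nonneg ht.1 _) (H.pos t ht.1).le)
    (fun a _ b _ h => h) antih i0 (i0.continuousOn_mul hc') (i0.continuousOn_mul hc)
    ((i0.continuousOn_mul hc).continuousOn_mul hc')
  have e1 : ∫ t in (0:ℝ)..s, (s - t) ^ 2 * (t ^ (e + 1) * f t) =
      ∫ t in (0:ℝ)..s, t * ((s - t) ^ 2 * (t ^ e * f t)) := by
    apply intervalIntegral.integral_congr
    intro t ht
    rw [uIcc_of_le hs.le] at ht
    simp only [(pw he ht.1).1]
    ring
  have e2 : vN f (e + 1) s = ∫ t in (0:ℝ)..s, t * (t ^ e * f t) := by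
    apply intervalIntegral.integral_congr
    intro t ht
    rw [uIcc_of_le hs.le] at ht
    simp only [(pw he ht.1).1]
    ring
  rw [e1, e2]
  exact this

lemma main_ineq (H : VLC f q) {e s : ℝ} (he : -1 < e) (hs : 0 < s) :
    s ^ (e + 1) * f s * (s ^ 2 * vN f e s - 2 * s * vN f (e + 1) s + vN f (e + 2) s) ≤
      2 * vN f e s * (s * vN f (e + 1) s - vN f (e + 2) s) := by
  have c1 := H.cheb1 (by linarith : 0 < e + 1) hs
  have c2 := H.cheb2 he hs
  have b0 := H.ibp he hs
  have b1 := H.ibp (by linarith : -1 < e + 1) hs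
  have b2 := H.ibp (by linarith : -1 < e + 2) hs
  have hF : 0 < s ^ (e + 1) * f s := mul_pos (Real.rpow_pos_of_pos hs _) (H.pos s hs.le)
  have hQ := H.Qnonneg (e := e + 1) hs
  have hN1 := H.Npos (by linarith : -1 < e + 1) hs
  rw [show e + 1 + 1 = e + 2 by ring, (pw he hs.le).2.1] at b1
  rw [show e + 2 + 1 = e + 3 by ring, (pw he hs.le).2.2] at b2
  rw [(pw he hs.le).1] at b0 hF ⊢
  rw [show e + 1 + 1 = e + 2 by ring, show e + 1 + 2 = e + 3 by ring] at c1
  set N0 := vN f e s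
  set N1 := vN f (e + 1) s
  set N2 := vN f (e + 2) s
  set N3 := vN f (e + 3) s
  set Q0 := vQ f q (e + 1) s
  set Q1 := vQ f q (e + 2) s
  set Q2 := vQ f q (e + 3) s
  obtain ⟨F, hFd⟩ : ∃ F, F = s * s ^ e * f s := ⟨_, rfl⟩
  have b1' : (e + 2) * N1 = s * F + Q1 := by rw [hFd]; linarith
  have b2' : (e + 3) * N2 = s ^ 2 * F + Q2 := by rw [hFd]; linarith
  rw [← hFd] at b0 hF ⊢
  have hb : 0 < e + 1 := by linarith
  obtain ⟨X, hX⟩ : ∃ X, X = s ^ 2 * Q0 - 2 * s * Q1 + Q2 := ⟨_, rfl⟩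
  obtain ⟨Y, hY⟩ : ∃ Y, Y = s ^ 2 * N1 - 2 * s * N2 + N3 := ⟨_, rfl⟩
  obtain ⟨D, hD⟩ : ∃ D, D = s ^ 2 * N0 - 2 * s * N1 + N2 := ⟨_, rfl⟩
  obtain ⟨B, hB⟩ : ∃ B, B = s * N1 - N2 := ⟨_, rfl⟩
  rw [← hX, ← hY] at c1
  rw [← hY, ← hD] at c2
  rw [← hD, ← hB]
  have r1 : (e + 1) * D = X + 2 * B := by
    rw [hD, hX, hB]
    linear_combination s ^ 2 * b0 - 2 * s * b1' + b2'
  have r2 : F * Y ≤ 2 * B * N1 := by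
    have h1 := mul_le_mul_of_nonneg_left c2 hb.le
    have e1 : (e + 1) * (N0 * Y) = F * Y + Q0 * Y := by linear_combination Y * b0
    have e2 : (e + 1) * (N1 * D) = N1 * X + 2 * B * N1 := by linear_combination N1 * r1
    linarith
  have r3 : F * X ≤ 2 * B * Q0 := by
    have h1 := mul_le_mul_of_nonneg_left c1 hF.le
    have h2 := mul_le_mul_of_nonneg_left r2 hQ
    have : N1 * (F * X) ≤ N1 * (2 * B * Q0) := by linarith
    exact le_of_mul_le_mul_left this hN1
  have : (e + 1) * (F * D) ≤ (e + 1) * (2 * N0 * B) := by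
    have e1 : (e + 1) * (F * D) = F * X + 2 * B * F := by linear_combination F * r1
    have e2 : (e + 1) * (2 * N0 * B) = 2 * B * F + 2 * B * Q0 := by linear_combination 2 * B * b0
    linarith
  exact le_of_mul_le_mul_left this hb

lemma derN (H : VLC f q) {e s : ℝ} (he : -1 < e) (hs : 0 < s) :
    HasDerivAt (vN f e) (s ^ e * f s) s := by
  have hc : ∀ t, 0 < t → ContinuousAt (fun t => t ^ e * f t) t := fun t ht =>
    (Real.continuousAt_rpow_const _ _ (Or.inl ht.ne')).mul (H.der t ht.le).continuousAt
  refine intervalIntegral.integral_hasDerivAt_right (H.intN he hs.le) ?_ (hc s hs)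
  exact ContinuousAt.stronglyMeasurableAtFilter isOpen_Ioi (fun t ht => hc t ht) s hs

lemma contN (H : VLC f q) {e T : ℝ} (he : -1 < e) (hT : 0 ≤ T) :
    ContinuousOn (vN f e) (Icc 0 T) := by
  have := intervalIntegral.continuousOn_primitive_interval' (H.intN he hT) left_mem_uIcc
  rw [uIcc_of_le hT] at this
  exact this

lemma phi_nonpos (H : VLC f q) {e T : ℝ} (he : -1 < e) (hT : 0 < T) :
    2 * T * vN f e T * vN f (e + 2) T - vN f (e + 1) T * vN f (e + 2) T
      - T ^ 2 * vN f e T * vN f (e + 1) T ≤ 0 := by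
  have he1 : -1 < e + 1 := by linarith
  have he2 : -1 < e + 2 := by linarith
  have hd : ∀ s, 0 < s → HasDerivAt (fun s => 2 * s * vN f e s * vN f (e + 2) s
      - vN f (e + 1) s * vN f (e + 2) s - s ^ 2 * vN f e s * vN f (e + 1) s)
      (s ^ (e + 1) * f s * (s ^ 2 * vN f e s - 2 * s * vN f (e + 1) s + vN f (e + 2) s) -
      2 * vN f e s * (s * vN f (e + 1) s - vN f (e + 2) s)) s := by
    intro s hs
    have d0 := H.derN he hs
    have d1 := H.derN he1 hs
    have d2 := H.derN he2 hs
    have := ((((hasDerivAt_id s).const_mul 2).mul d0).mul d2).sub (d1.mul d2) |>.sub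
      (((hasDerivAt_pow 2 s).mul d0).mul d1)
    refine HasDerivAt.congr_deriv this ?_
    rw [(pw he hs.le).1, (pw he hs.le).2.1]
    simp
    ring
  have anti : AntitoneOn (fun s => 2 * s * vN f e s * vN f (e + 2) s
      - vN f (e + 1) s * vN f (e + 2) s - s ^ 2 * vN f e s * vN f (e + 1) s) (Icc 0 T) := by
    apply antitoneOn_of_deriv_nonpos (convex_Icc 0 T)
    · have c0 := H.contN he hT.le
      have c1 := H.contN he1 hT.le
      have c2 := H.contN he2 hT.le
      fun_prop
    · intro s hs
      rw [interior_Icc] at hs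
      exact (hd s hs.1).differentiableAt.differentiableWithinAt
    · intro s hs
      rw [interior_Icc] at hs
      rw [(hd s hs.1).deriv]
      linarith [H.main_ineq he hs.1]
  have := anti (left_mem_Icc.2 hT.le) (right_mem_Icc.2 hT.le) hT.le
  simpa [vN] using this

lemma ratio (H : VLC f q) {e s T : ℝ} (he : -1 < e) (hs : 0 < s) (hsT : s ≤ T) :
    vN f (e + 1) T ^ 2 * (vN f e s * vN f (e + 2) s) ≤
      vN f (e + 1) s ^ 2 * (vN f e T * vN f (e + 2) T) := by
  have he1 : -1 < e + 1 := by linarith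
  have he2 : -1 < e + 2 := by linarith
  have hp : ∀ s, 0 < s → 0 < vN f e s * vN f (e + 2) s := fun s hs =>
    mul_pos (H.Npos he hs) (H.Npos he2 hs)
  have hd : ∀ s, 0 < s → HasDerivAt (fun s => vN f (e + 1) s ^ 2 / (vN f e s * vN f (e + 2) s))
      (s ^ e * f s * vN f (e + 1) s * (2 * s * vN f e s * vN f (e + 2) s
        - vN f (e + 1) s * vN f (e + 2) s - s ^ 2 * vN f e s * vN f (e + 1) s) /
        (vN f e s * vN f (e + 2) s) ^ 2) s := by
    intro s hs
    have d0 := H.derN he hs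
    have d1 := H.derN he1 hs
    have d2 := H.derN he2 hs
    have := (d1.pow 2).div (d0.mul d2) (hp s hs).ne'
    refine HasDerivAt.congr_deriv this ?_
    rw [(pw he hs.le).1, (pw he hs.le).2.1]
    simp
    ring
  have anti : AntitoneOn (fun s => vN f (e + 1) s ^ 2 / (vN f e s * vN f (e + 2) s)) (Ioi 0) := by
    apply antitoneOn_of_deriv_nonpos (convex_Ioi 0)
    · intro s hs
      exact (hd s hs).continuousAt.continuousWithinAt
    · intro s hs
      rw [interior_Ioi] at hs
      exact (hd s hs).differentiableAt.differentiableWithinAt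
    · intro s hs
      rw [interior_Ioi] at hs
      rw [(hd s hs).deriv]
      apply div_nonpos_of_nonpos_of_nonneg _ (sq_nonneg _)
      apply mul_nonpos_of_nonneg_of_nonpos _ (H.phi_nonpos he hs)
      exact (mul_pos (mul_pos (Real.rpow_pos_of_pos hs _) (H.pos s (le_of_lt hs)))
        (H.Npos he1 hs)).le
  have hT : 0 < T := hs.trans_le hsT
  have := anti (show s ∈ Ioi 0 from hs) (show T ∈ Ioi 0 from hT) hsT
  exact (div_le_div_iff₀ (hp T hT) (hp s hs)).1 this

lemma final (H : VLC f q) {e s : ℝ} (he : -1 < e) (hs : 0 < s)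
    (hi : ∀ e : ℝ, -1 < e → IntegrableOn (fun t => t ^ e * f t) (Ioi 0)) :
    (∫ t in Ioi (0:ℝ), t ^ (e + 1) * f t) ^ 2 * (vN f e s * vN f (e + 2) s) ≤
      vN f (e + 1) s ^ 2 *
        ((∫ t in Ioi (0:ℝ), t ^ e * f t) * (∫ t in Ioi (0:ℝ), t ^ (e + 2) * f t)) := by
  have ht : ∀ e : ℝ, -1 < e → Filter.Tendsto (vN f e) Filter.atTop
      (nhds (∫ t in Ioi (0:ℝ), t ^ e * f t)) := fun e he =>
    intervalIntegral_tendsto_integral_Ioi 0 (hi e he) Filter.tendsto_id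
  refine le_of_tendsto_of_tendsto
    (((ht (e + 1) (by linarith)).pow 2).mul_const _)
    (((ht e he).mul (ht (e + 2) (by linarith))).const_mul _) ?_
  filter_upwards [Filter.eventually_ge_atTop s] with T hT
  exact H.ratio he hs hT

end VLC

noncomputable def vf (x α t : ℝ) : ℝ := x ^ (t + α) / Real.Gamma (t + α + 1)
noncomputable def vq (x α t : ℝ) : ℝ :=
  -Real.log x + deriv (Real.log ∘ Real.Gamma) (t + α + 1)

lemma v_diffGamma {t : ℝ} (ht : 0 < t) : DifferentiableAt ℝ Real.Gamma t :=
  Real.differentiableAt_Gamma (fun m => by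
    have : (0:ℝ) ≤ m := Nat.cast_nonneg m
    linarith)

lemma v_diff {t : ℝ} (ht : 0 < t) : DifferentiableAt ℝ (Real.log ∘ Real.Gamma) t :=
  (v_diffGamma ht).log (Real.Gamma_pos_of_pos ht).ne'

lemma v_VLC (x α zstar : ℝ)
    (hx0 : 0 < x) (hx1 : x < 1)
    (hzstar : zstar ∈ Set.Ioi (0 : ℝ))
    (hmin : ∀ y ∈ Set.Ioi (0 : ℝ), Real.Gamma zstar ≤ Real.Gamma y)
    (hα : zstar < α) : VLC (vf x α) (vq x α) := by
  have hz : 0 < zstar := hzstar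
  have hmono : MonotoneOn (deriv (Real.log ∘ Real.Gamma)) (Ioi 0) :=
    Real.convexOn_log_Gamma.monotoneOn_deriv (fun t ht => v_diff ht)
  refine ⟨?_, ?_, ?_, ?_⟩
  · intro t ht
    exact div_pos (Real.rpow_pos_of_pos hx0 _) (Real.Gamma_pos_of_pos (by linarith))
  · intro t ht
    have hp : 0 < t + α + 1 := by linarith
    have hG := Real.Gamma_pos_of_pos hp
    have e1 : deriv (Real.log ∘ Real.Gamma) (t + α + 1) =
        deriv Real.Gamma (t + α + 1) / Real.Gamma (t + α + 1) :=
      ((v_diffGamma hp).hasDerivAt.log hG.ne').deriv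
    have d1 : HasDerivAt (fun t => Real.Gamma (t + α + 1)) (deriv Real.Gamma (t + α + 1)) t := by
      have h := (v_diffGamma hp).hasDerivAt.comp t
        (((hasDerivAt_id t).add_const α).add_const 1)
      rw [mul_one] at h
      exact h
    have d2 : HasDerivAt (fun t => x ^ (t + α)) (Real.log x * 1 * x ^ (t + α)) t :=
      ((hasDerivAt_id t).add_const α).const_rpow hx0
    have d3 := d2.div d1 hG.ne'
    refine HasDerivAt.congr_deriv d3 ?_
    simp only [vq, vf, e1]
    field_simp
    ring
  · intro a ha b hb hab
    have ha' : 0 ≤ a := ha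
    have hb' : 0 ≤ b := hb
    have := hmono (show a + α + 1 ∈ Ioi 0 by simp only [mem_Ioi]; linarith)
      (show b + α + 1 ∈ Ioi 0 by simp only [mem_Ioi]; linarith) (by linarith)
    simp only [vq]
    linarith
  · intro t ht
    have h0 : deriv (Real.log ∘ Real.Gamma) zstar = 0 := by
      apply IsLocalMin.deriv_eq_zero
      filter_upwards [Ioi_mem_nhds hz] with y hy
      exact Real.log_le_log (Real.Gamma_pos_of_pos hz) (hmin y hy)
    have := hmono hzstar (show t + α + 1 ∈ Ioi 0 by simp only [mem_Ioi]; linarith) (by linarith)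
    have := Real.log_neg hx0 hx1
    simp only [vq]
    linarith

lemma v_int (x α zstar e : ℝ)
    (hx0 : 0 < x) (hx1 : x < 1)
    (hzstar : zstar ∈ Set.Ioi (0 : ℝ))
    (hmin : ∀ y ∈ Set.Ioi (0 : ℝ), Real.Gamma zstar ≤ Real.Gamma y)
    (hα : zstar < α) (he : -1 < e) : IntegrableOn (fun t => t ^ e * vf x α t) (Ioi 0) := by
  have hz : 0 < zstar := hzstar
  have H := v_VLC x α zstar hx0 hx1 hzstar hmin hα
  have hl := Real.log_neg hx0 hx1
  have h1 := integrableOn_rpow_mul_exp_neg_mul_rpow (p := 1) (b := -Real.log x) he one_pos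
    (by linarith)
  refine Integrable.mono' (h1.const_mul (x ^ α / Real.Gamma zstar)) ?_ ?_
  · apply ContinuousOn.aestronglyMeasurable _ measurableSet_Ioi
    intro t ht
    exact ((Real.continuousAt_rpow_const _ _ (Or.inl (ne_of_gt ht))).mul
      (H.der t (le_of_lt ht)).continuousAt).continuousWithinAt
  · filter_upwards [ae_restrict_mem measurableSet_Ioi] with t ht
    have ht' : 0 < t := ht
    have hp := Real.rpow_pos_of_pos ht' e
    rw [Real.norm_of_nonneg (mul_pos hp (H.pos t ht'.le)).le]
    have e1 : x ^ α / Real.Gamma zstar * (t ^ e * Real.exp (- -Real.log x * t ^ (1:ℝ))) =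
        t ^ e * (x ^ (t + α) / Real.Gamma zstar) := by
      rw [Real.rpow_one, neg_neg, Real.rpow_add hx0, Real.rpow_def_of_pos hx0 t]
      ring
    rw [e1]
    apply mul_le_mul_of_nonneg_left _ hp.le
    apply div_le_div_of_nonneg_left (Real.rpow_pos_of_pos hx0 _).le (Real.Gamma_pos_of_pos hz)
    exact hmin _ (show 0 < t + α + 1 by linarith)

lemma v_GStar (β x α s : ℝ) (hs : 0 < s) (hβ : -1 < β) :
    volterraGStar β x α s =
      vN (vf x α) β s / ∫ t in Ioi (0:ℝ), t ^ β * vf x α t := by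
  have hG : (Real.Gamma (β + 1))⁻¹ ≠ 0 :=
    inv_ne_zero (Real.Gamma_pos_of_pos (by linarith)).ne'
  have e : ∀ t : ℝ, x ^ (t + α) * t ^ β / (Real.Gamma (t + α + 1) * Real.Gamma (β + 1)) =
      (Real.Gamma (β + 1))⁻¹ * (t ^ β * vf x α t) := by
    intro t
    simp only [vf, div_eq_mul_inv, mul_inv]
    ring
  unfold volterraGStar volterraMuIncStar volterraMu vN
  simp only [e, integral_const_mul]
  rw [intervalIntegral.integral_of_le hs.le, mul_div_mul_left _ _ hG]

/-- Turán type inequality for the normalized incomplete Volterra function `G*_β`. -/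
theorem volterraGStar_turan (x α s β zstar : ℝ)
    (hx0 : 0 < x) (hx1 : x < 1) (hs : 0 < s) (hβ : -1 < β)
    (hzstar : zstar ∈ Set.Ioi (0 : ℝ))
    (hmin : ∀ y ∈ Set.Ioi (0 : ℝ), Real.Gamma zstar ≤ Real.Gamma y)
    (hα : zstar < α) :
    0 ≤ volterraGStar (β + 1) x α s ^ 2 -
      volterraGStar β x α s * volterraGStar (β + 2) x α s := by
  have H := v_VLC x α zstar hx0 hx1 hzstar hmin hα
  have hi := fun e he => v_int x α zstar e hx0 hx1 hzstar hmin hα he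
  have hf := H.final hβ hs hi
  rw [v_GStar β x α s hs hβ, v_GStar (β + 1) x α s hs (by linarith),
    v_GStar (β + 2) x α s hs (by linarith)]
  have hMpos : ∀ e : ℝ, -1 < e → 0 < ∫ t in Ioi (0:ℝ), t ^ e * vf x α t := by
    intro e he
    have h1 : vN (vf x α) e 1 ≤ ∫ t in Ioi (0:ℝ), t ^ e * vf x α t := by
      unfold vN
      rw [intervalIntegral.integral_of_le zero_le_one]
      apply setIntegral_mono_set (hi e he) _ (Filter.Eventually.of_forall (fun t ht => ht.1))
      filter_upwards [ae_restrict_mem measurableSet_Ioi] with t ht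
      exact (mul_pos (Real.rpow_pos_of_pos ht e) (H.pos t (le_of_lt ht))).le
    exact (H.Npos he one_pos).trans_le h1
  have p0 := hMpos β hβ
  have p1 := hMpos (β + 1) (by linarith)
  have p2 := hMpos (β + 2) (by linarith)
  rw [sub_nonneg, div_pow, div_mul_div_comm, div_le_div_iff₀ (mul_pos p0 p2) (pow_pos p1 2)]
  linarith
end
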